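/- arXiv:2301.02569 — 3 statements merged into one kernel-verified Lean document; each statement's English description precedes it below -/
import Mathlib

section
/- For any graph G, the matched treewidth of G is at most 2·tw(G) + 1, where tw(G) is the treewidth of G. -/
/-- A tree decomposition of `G`. -/
structure TreeDecomp {V : Type} (G : SimpleGraph V) where
  ι : Type
  tree : SimpleGraph ι
  isTree : tree.IsTree
  bag : ι → Set V
  vert_conn : ∀ v : V, (tree.induce {i | v ∈ bag i}).Connected
  edge_cover : ∀ u v : V, G.Adj u v → ∃ i, u ∈ bag i ∧ v ∈ bag i

/-- Treewidth: minimum over tree decompositions of (max bag size - 1). -/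
noncomputable def treewidth {V : Type} (G : SimpleGraph V) : ℕ :=
  sInf {k | ∃ D : TreeDecomp G, ∀ i, (D.bag i).ncard ≤ k + 1}

/-- A set of vertices is matched if the induced subgraph has a perfect
matching, or a matching missing exactly one vertex that is adjacent to a
matched vertex. -/
def MatchedSet {V : Type} (G : SimpleGraph V) (S : Set V) : Prop :=
  (∃ M : G.Subgraph, M.IsMatching ∧ M.verts = S) ∨
  (∃ (M : G.Subgraph) (v : V), M.IsMatching ∧ v ∈ S ∧ M.verts = S \ {v} ∧
      ∃ u ∈ M.verts, G.Adj v u)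

/-- A matched tree decomposition: every bag is matched. -/
def TreeDecomp.IsMatched {V : Type} {G : SimpleGraph V} (D : TreeDecomp G) : Prop :=
  ∀ i, MatchedSet G (D.bag i)

/-- Matched treewidth. -/
noncomputable def mtw {V : Type} (G : SimpleGraph V) : ℕ :=
  sInf {k | ∃ D : TreeDecomp G, D.IsMatched ∧ ∀ i, (D.bag i).ncard ≤ k + 1}

namespace MatchedTreewidth

open Set

variable {V : Type} {G : SimpleGraph V}

/-- Some set `Y ⊆ U` containing every neighbor in `U` of `R` is matched by `g` into a subset of `S`
whose neighbors in `U` all lie in `Y`. In the transversal matroid of the vertices matchable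
into `U`, this says that `R` lies in the closure of `S`. -/
def Spans (G : SimpleGraph V) (S U R : Set V) : Prop :=
  ∃ (Y : Set V) (g : V → V), Y ⊆ U ∧ InjOn g Y ∧ (∀ y ∈ Y, g y ∈ S ∧ G.Adj (g y) y) ∧
    (∀ y ∈ Y, ∀ u ∈ U, G.Adj (g y) u → u ∈ Y) ∧ ∀ x ∈ R, ∀ u ∈ U, G.Adj x u → u ∈ Y

/-- The greedy basis, along `ρ`, of the vertices of `A` matchable into `U`. -/
def greedyBasis (G : SimpleGraph V) (ρ : V → ℕ) (A U : Set V) : Set V :=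
  {x ∈ A | ¬ Spans G {y ∈ A | ρ y < ρ x} U {x}}

lemma Spans.mono {S S' U U' R : Set V} (h : Spans G S U R) (hS : S ⊆ S') (hU : U' ⊆ U) :
    Spans G S' U' R := by
  obtain ⟨Y, g, hYU, hg, hgS, hN, hR⟩ := h
  exact ⟨Y ∩ U', g, inter_subset_right, hg.mono inter_subset_left,
    fun y hy => ⟨hS (hgS y hy.1).1, (hgS y hy.1).2⟩,
    fun y hy u hu h => ⟨hN y hy.1 u (hU hu) h, hu⟩,
    fun x hx u hu h => ⟨hR x hx u (hU hu) h, hu⟩⟩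

lemma Spans.trans {S S' U R R' : Set V} (h : Spans G S U R) (h' : Spans G S' U R')
    (hS : S' \ S ⊆ R) : Spans G S U (R ∪ R') := by
  classical
  obtain ⟨Y, g, hYU, hg, hgS, hN, hR⟩ := h
  obtain ⟨Y', g', hYU', hg', hgS', hN', hR'⟩ := h'
  refine ⟨Y ∪ Y', fun y => if y ∈ Y then g y else g' y, union_subset hYU hYU', ?_, ?_, ?_, ?_⟩
  · intro a ha b hb hab
    have key : ∀ a b, a ∈ Y → b ∈ Y' → b ∉ Y → g a ≠ g' b := fun a b ha hb hb' h =>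
      hb' (hN a ha b (hYU' hb) (h ▸ (hgS' b hb).2))
    by_cases h1 : a ∈ Y <;> by_cases h2 : b ∈ Y <;> simp only [h1, h2, if_true, if_false] at hab
    · exact hg h1 h2 hab
    · exact absurd hab (key a b h1 (hb.resolve_left h2) h2)
    · exact absurd hab.symm (key b a h2 (ha.resolve_left h1) h1)
    · exact hg' (ha.resolve_left h1) (hb.resolve_left h2) hab
  · intro y hy
    by_cases h1 : y ∈ Y
    · simpa [h1] using hgS y h1
    · have hy' := hgS' y (hy.resolve_left h1)
      simp only [h1, if_false]
      refine ⟨by_contra fun hc => h1 ?_, hy'.2⟩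
      exact hR _ (hS ⟨hy'.1, hc⟩) y (hYU' (hy.resolve_left h1)) hy'.2
  · intro y hy u hu h
    by_cases h1 : y ∈ Y
    · exact Or.inl (hN y h1 u hu (by simpa [h1] using h))
    · exact Or.inr (hN' y (hy.resolve_left h1) u hu (by simpa [h1] using h))
  · rintro x (hx | hx) u hu h
    · exact Or.inl (hR x hx u hu h)
    · exact Or.inr (hR' x hx u hu h)

lemma Spans.of_forall [Finite V] {S U R : Set V} (h : ∀ x ∈ R, Spans G S U {x}) :
    Spans G S U R := by
  induction R, R.toFinite using Set.Finite.induction_on with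
  | empty => exact ⟨∅, id, by simp⟩
  | @insert a s _ _ ih =>
    exact (h a (mem_insert _ _)).trans (ih fun x hx => h x (mem_insert_of_mem _ hx)) (by simp)

lemma greedyBasis_subset (ρ : V → ℕ) (A U : Set V) : greedyBasis G ρ A U ⊆ A := fun _ h => h.1

lemma greedyBasis_anti {ρ ρ' : V → ℕ} {A A' U U' : Set V}
    (hρ : ∀ x ∈ A, ∀ y ∈ A, ρ y < ρ x → ρ' y < ρ' x) (hA : A ⊆ A') (hU : U' ⊆ U) :
    greedyBasis G ρ' A' U' ∩ A ⊆ greedyBasis G ρ A U := fun x ⟨hx, hxA⟩ =>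
  ⟨hxA, fun h => hx.2 (h.mono (fun _ hy => ⟨hA hy.1, hρ x hxA _ hy.1 hy.2⟩) hU)⟩

lemma exists_adj_of_mem_greedyBasis {ρ : V → ℕ} {A U : Set V} {x : V}
    (hx : x ∈ greedyBasis G ρ A U) : ∃ u ∈ U, G.Adj x u := by
  by_contra! h
  exact hx.2 ⟨∅, id, by simpa using h⟩

/-- Every edge between the two sides of a cut meets one of the two greedy bases. -/
lemma mem_greedyBasis_or [Finite V] {ρ ρ' : V → ℕ} {A U : Set V} {x u : V}
    (hx : x ∈ A) (hu : u ∈ U) (hxu : G.Adj x u) :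
    x ∈ greedyBasis G ρ A U ∨ u ∈ greedyBasis G ρ' U A := by
  by_contra! hc
  have h1 : Spans G {y ∈ A | ρ y < ρ x} U {x} := by_contra fun h => hc.1 ⟨hx, h⟩
  have h2 : Spans G {y ∈ U | ρ' y < ρ' u} A {u} := by_contra fun h => hc.2 ⟨hu, h⟩
  obtain ⟨Y, g, hYU, hg, hgS, hN, hR⟩ := h1
  obtain ⟨Y', g', hYU', hg', hgS', hN', hR'⟩ := h2
  have hxY' : x ∈ Y' := hR' u rfl x hx hxu.symm
  have hxT : x ∉ g '' Y := by
    rintro ⟨y, hy, rfl⟩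
    exact (hgS y hy).1.2.ne rfl
  have h3 : (Y ∩ g' '' Y').ncard ≤ (g '' Y ∩ Y').ncard := by
    refine ncard_le_ncard_of_injOn g ?_ (hg.mono inter_subset_left) (toFinite _)
    rintro _ ⟨hy, y, hy', rfl⟩
    exact ⟨mem_image_of_mem _ hy, hN' y hy' _ (hgS _ hy).1.1 (hgS _ hy).2.symm⟩
  have h4 : (insert x (g '' Y ∩ Y')).ncard ≤ (Y ∩ g' '' Y').ncard := by
    refine ncard_le_ncard_of_injOn g' ?_ (hg'.mono (insert_subset hxY' inter_subset_right))
      (toFinite _)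
    rintro t (rfl | ⟨⟨y, hy, rfl⟩, ht⟩)
    · exact ⟨hR t rfl _ (hgS' t hxY').1.1 (hgS' t hxY').2.symm, mem_image_of_mem _ hxY'⟩
    · exact ⟨hN y hy _ (hgS' _ ht).1.1 (hgS' _ ht).2.symm, mem_image_of_mem _ ht⟩
  rw [ncard_insert_of_notMem fun h => hxT h.1] at h4
  omega

lemma exists_injOn_of_forall_not_spans [Finite V] {ρ : V → ℕ} (hρ : ρ.Injective) {U : Set V}
    (T : Finset V) (hT : ∀ x ∈ T, ¬ Spans G {y ∈ (T : Set V) | ρ y < ρ x} U {x}) :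
    ∃ f : V → V, InjOn f T ∧ ∀ x ∈ T, f x ∈ U ∧ G.Adj x (f x) := by
  classical
  have := Fintype.ofFinite V
  induction T using Finset.strongInduction with
  | H T ih =>
  have ih' : ∀ S ⊂ T, ∃ f : V → V, InjOn f S ∧ ∀ x ∈ S, f x ∈ U ∧ G.Adj x (f x) := fun S hS =>
    ih S hS fun x hx h => hT x (hS.1 hx) (h.mono (fun y hy => ⟨hS.1 hy.1, hy.2⟩) subset_rfl)
  let N : V → Finset V := fun x => {u | u ∈ U ∧ G.Adj x u}
  have hall : ∀ S ⊆ T, S.card ≤ (S.biUnion N).card := by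
    intro S hS
    rcases S.eq_empty_or_nonempty with rfl | hne
    · simp
    rcases hS.eq_or_ssubset with rfl | hS
    · obtain ⟨x, hx, hmax⟩ := S.exists_max_image ρ hne
      obtain ⟨f, hf, hfU⟩ := ih' (S.erase x) (Finset.erase_ssubset hx)
      by_contra! hlt
      have hsub : (S.erase x).image f ⊆ S.biUnion N := by
        intro u hu
        obtain ⟨y, hy, rfl⟩ := Finset.mem_image.1 hu
        exact Finset.mem_biUnion.2 ⟨y, Finset.mem_of_mem_erase hy, by simpa [N] using hfU y hy⟩
      have himg : (S.erase x).image f = S.biUnion N := by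
        refine Finset.eq_of_subset_of_card_le hsub ?_
        rw [Finset.card_image_of_injOn hf, Finset.card_erase_of_mem hx]
        omega
      have hinv : ∀ u ∈ S.biUnion N, ∃ y ∈ S.erase x, f y = u := fun u hu =>
        Finset.mem_image.1 (himg ▸ hu)
      choose! g hgS hfg using hinv
      have hmem : ∀ y ∈ S, ∀ u ∈ U, G.Adj y u → u ∈ S.biUnion N := fun y hy u hu h =>
        Finset.mem_biUnion.2 ⟨y, hy, by simp [N, hu, h]⟩
      refine hT x hx ⟨S.biUnion N, g, ?_, ?_, ?_, ?_, ?_⟩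
      · intro u hu
        simp only [N, Finset.coe_biUnion, mem_iUnion] at hu
        obtain ⟨i, -, hi⟩ := hu
        simp at hi
        exact hi.1
      · intro a ha b hb hab
        rw [← hfg a ha, ← hfg b hb, hab]
      · intro y hy
        have h1 := hgS y hy
        have h2 := Finset.mem_erase.1 h1
        refine ⟨⟨h2.2, lt_of_le_of_ne (hmax _ h2.2) fun h => h2.1 (hρ h)⟩, ?_⟩
        simpa [hfg y hy] using (hfU _ h1).2
      · exact fun y hy u hu h => hmem _ (Finset.mem_of_mem_erase (hgS y hy)) u hu h
      · rintro _ rfl u hu h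
        exact hmem _ hx u hu h
    · obtain ⟨f, hf, hfU⟩ := ih' S hS
      rw [← Finset.card_image_of_injOn hf]
      refine Finset.card_le_card fun u hu => ?_
      obtain ⟨y, hy, rfl⟩ := Finset.mem_image.1 hu
      exact Finset.mem_biUnion.2 ⟨y, hy, by simpa [N] using hfU y hy⟩
  obtain ⟨f, hf, hfN⟩ := (Finset.all_card_le_biUnion_card_iff_exists_injective
    (fun x : T => N x)).1 fun S => by
      have := hall (S.map (Function.Embedding.subtype _)) (by intro; simp +contextual)
      rw [Finset.card_map, Finset.map_eq_image, Finset.image_biUnion] at this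
      exact this
  refine ⟨fun x => if h : x ∈ T then f ⟨x, h⟩ else x, ?_, ?_⟩
  · intro a ha b hb hab
    simp only [Finset.mem_coe] at ha hb
    simp only [ha, hb, dif_pos] at hab
    simpa using hf hab
  · intro x hx
    have := hfN ⟨x, hx⟩
    simpa [hx, N] using this

lemma spans_greedyBasis [Finite V] (ρ : V → ℕ) (A U : Set V) :
    Spans G (greedyBasis G ρ A U) U (A \ greedyBasis G ρ A U) := by
  refine Spans.of_forall fun x => ?_
  induction h : ρ x using Nat.strong_induction_on generalizing x with
  | _ n ih =>
  subst h
  rintro ⟨hxA, hx⟩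
  have h1 : Spans G {y ∈ A | ρ y < ρ x} U {x} := by_contra fun h => hx ⟨hxA, h⟩
  have h2 : Spans G (greedyBasis G ρ A U) U ({y ∈ A | ρ y < ρ x} \ greedyBasis G ρ A U) :=
    Spans.of_forall fun y hy => ih _ hy.1.2 y rfl ⟨hy.1.1, hy.2⟩
  obtain ⟨Y, g, a, b, c, d, e⟩ := h2.trans h1 subset_rfl
  exact ⟨Y, g, a, b, c, d, fun y hy => e y (Or.inr hy)⟩

/-- One greedy basis can be matched into the greedy basis of the other side. -/
lemma exists_injOn_greedyBasis [Finite V] {ρ : V → ℕ} (hρ : ρ.Injective) (ρ' : V → ℕ)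
    (A U : Set V) : ∃ f : V → V, InjOn f (greedyBasis G ρ A U) ∧
      ∀ x ∈ greedyBasis G ρ A U, f x ∈ greedyBasis G ρ' U A ∧ G.Adj x (f x) := by
  classical
  obtain ⟨f, hf, hfU⟩ := exists_injOn_of_forall_not_spans (G := G) hρ (U := U)
    (greedyBasis G ρ A U).toFinite.toFinset (by
      intro x hx h
      rw [Finite.mem_toFinset] at hx
      refine hx.2 (h.mono ?_ subset_rfl)
      rintro y ⟨hy, hy'⟩
      rw [Finite.coe_toFinset] at hy
      exact ⟨hy.1, hy'⟩)
  simp only [Finite.mem_toFinset, Finite.coe_toFinset] at hf hfU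
  obtain ⟨Y, g, hYA, hg, hgS, hN, hR⟩ := spans_greedyBasis (G := G) ρ' U A
  have key : ∀ a b, a ∈ Y → b ∈ greedyBasis G ρ A U → b ∉ Y → g a ≠ f b := fun a b ha hb hbY h =>
    hbY (hN a ha b hb.1 (h ▸ (hfU b hb).2.symm))
  refine ⟨fun x => if x ∈ Y then g x else f x, ?_, ?_⟩
  · intro a ha b hb hab
    by_cases h1 : a ∈ Y <;> by_cases h2 : b ∈ Y <;> simp only [h1, h2, if_true, if_false] at hab
    · exact hg h1 h2 hab
    · exact absurd hab (key a b h1 hb h2)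
    · exact absurd hab.symm (key b a h2 ha h1)
    · exact hf ha hb hab
  · intro x hx
    by_cases h1 : x ∈ Y
    · simp only [h1, if_true]
      exact ⟨(hgS x h1).1, (hgS x h1).2.symm⟩
    · simp only [h1, if_false]
      refine ⟨by_contra fun hc => h1 (hR _ ⟨(hfU x hx).1, hc⟩ x hx.1 (hfU x hx).2.symm),
        (hfU x hx).2⟩

lemma ncard_greedyBasis [Finite V] {ρ ρ' : V → ℕ} (hρ : ρ.Injective) (hρ' : ρ'.Injective)
    (A U : Set V) : (greedyBasis G ρ A U).ncard = (greedyBasis G ρ' U A).ncard := by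
  obtain ⟨f, hf, hfm⟩ := exists_injOn_greedyBasis (G := G) hρ ρ' A U
  obtain ⟨g, hg, hgm⟩ := exists_injOn_greedyBasis (G := G) hρ' ρ U A
  exact le_antisymm (ncard_le_ncard_of_injOn f (fun x hx => (hfm x hx).1) hf (toFinite _))
    (ncard_le_ncard_of_injOn g (fun x hx => (hgm x hx).1) hg (toFinite _))

lemma exists_isMatching_greedyBasis [Finite V] {ρ ρ' : V → ℕ} (hρ : ρ.Injective)
    (hρ' : ρ'.Injective) {A U : Set V} (hAU : Disjoint A U) :
    ∃ M : G.Subgraph, M.verts = greedyBasis G ρ A U ∪ greedyBasis G ρ' U A ∧ M.IsMatching := by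
  obtain ⟨f, hf, hfm⟩ := exists_injOn_greedyBasis (G := G) hρ ρ' A U
  let F : greedyBasis G ρ A U → greedyBasis G ρ' U A := fun x => ⟨f x, (hfm x x.2).1⟩
  have hF : F.Injective := fun a b hab =>
    Subtype.ext (hf a.2 b.2 (congrArg Subtype.val hab))
  have hb := hF.bijective_of_nat_card_le (ncard_greedyBasis hρ hρ' A U).ge
  exact SimpleGraph.Subgraph.IsMatching.exists_of_disjoint_sets_of_equiv
    (hAU.mono (greedyBasis_subset _ _ _) (greedyBasis_subset _ _ _)) (Equiv.ofBijective F hb)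
    fun x => (hfm x x.2).2

lemma exists_of_mem_support_map {α β : Type} {S : SimpleGraph α} {T : SimpleGraph β} {f : S →g T}
    {a b : α} (p : S.Walk a b) {x : β} (hx : x ∈ (p.map f).support) : ∃ y ∈ p.support, f y = x := by
  simpa using hx

lemma isTree_sum_sup_edge {α β : Type} {S : SimpleGraph α} {T : SimpleGraph β}
    (hS : S.IsTree) (hT : T.IsTree) (a : α) (b : β) :
    (S.sum T ⊔ SimpleGraph.edge (.inl a) (.inr b)).IsTree := by
  refine ⟨hS.connected.sum_sup_edge hT.connected, ?_⟩
  rw [SimpleGraph.isAcyclic_add_edge_iff_of_not_reachable _ _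
    (SimpleGraph.not_reachable_sum_inl_inr a b)]
  have hS' := SimpleGraph.isAcyclic_iff_forall_adj_isBridge.1 hS.isAcyclic
  have hT' := SimpleGraph.isAcyclic_iff_forall_adj_isBridge.1 hT.isAcyclic
  rw [SimpleGraph.isAcyclic_iff_forall_adj_isBridge]
  rintro (v | v) (w | w) h
  · rw [SimpleGraph.sum_adj_inl] at h
    have h1 := hS' h
    rw [SimpleGraph.isBridge_iff] at h1 ⊢
    rintro ⟨p⟩
    refine h1 ?_
    suffices H : ∀ x y, ((S.sum T).deleteEdges {s(.inl v, .inl w)}).Walk x y → ∀ c, x = .inl c →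
        ∃ d, y = .inl d ∧ (S.deleteEdges {s(v, w)}).Reachable c d by
      obtain ⟨d, hd, hr⟩ := H _ _ p v rfl
      exact Sum.inl.inj hd ▸ hr
    intro x y p
    induction p with
    | nil => exact fun c hc => ⟨c, hc, .rfl⟩
    | @cons _ z _ hadj p ih =>
      rintro c rfl
      rcases z with z | z
      · obtain ⟨d, hd, hr⟩ := ih z rfl
        refine ⟨d, hd, .trans (SimpleGraph.Adj.reachable ?_) hr⟩
        simpa [SimpleGraph.deleteEdges_adj] using hadj
      · simp [SimpleGraph.deleteEdges_adj] at hadj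
  · simp at h
  · simp at h
  · rw [SimpleGraph.sum_adj_inr] at h
    have h1 := hT' h
    rw [SimpleGraph.isBridge_iff] at h1 ⊢
    rintro ⟨p⟩
    refine h1 ?_
    suffices H : ∀ x y, ((S.sum T).deleteEdges {s(.inr v, .inr w)}).Walk x y → ∀ c, x = .inr c →
        ∃ d, y = .inr d ∧ (T.deleteEdges {s(v, w)}).Reachable c d by
      obtain ⟨d, hd, hr⟩ := H _ _ p v rfl
      exact Sum.inr.inj hd ▸ hr
    intro x y p
    induction p with
    | nil => exact fun c hc => ⟨c, hc, .rfl⟩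
    | @cons _ z _ hadj p ih =>
      rintro c rfl
      rcases z with z | z
      · simp [SimpleGraph.deleteEdges_adj] at hadj
      · obtain ⟨d, hd, hr⟩ := ih z rfl
        refine ⟨d, hd, .trans (SimpleGraph.Adj.reachable ?_) hr⟩
        simpa [SimpleGraph.deleteEdges_adj] using hadj

/-- There is a tree of bags satisfying `P`, with root bag `X` and with union of bags `W`, in which
the bags containing a given vertex are connected and every pair related by `E` shares a bag. -/
def HasRootedDecomp (P : Set V → Prop) (X W : Set V) (E : V → V → Prop) : Prop :=
  ∃ (ι : Type) (T : SimpleGraph ι) (r : ι) (bag : ι → Set V), T.IsTree ∧ bag r = X ∧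
    (∀ i, P (bag i)) ∧
    (∀ v i j, v ∈ bag i → v ∈ bag j → ∃ p : T.Walk i j, ∀ x ∈ p.support, v ∈ bag x) ∧
    (∀ v, v ∈ W ↔ ∃ i, v ∈ bag i) ∧ ∀ u v, E u v → ∃ i, u ∈ bag i ∧ v ∈ bag i

lemma HasRootedDecomp.mono {P : Set V → Prop} {X W W' : Set V} {E E' : V → V → Prop}
    (h : HasRootedDecomp P X W E) (hW : W = W') (hE : ∀ u v, E' u v → E u v ∨ E v u) :
    HasRootedDecomp P X W' E' := by
  subst hW
  obtain ⟨ι, T, r, bag, hT, hr, hP, hc, hW, hE'⟩ := h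
  refine ⟨ι, T, r, bag, hT, hr, hP, hc, hW, fun u v huv => ?_⟩
  rcases hE u v huv with h | h
  · exact hE' u v h
  · exact (hE' v u h).imp fun _ => And.symm

lemma HasRootedDecomp.single {P : Set V → Prop} {X : Set V} (hX : P X) :
    HasRootedDecomp P X X fun u v => u ∈ X ∧ v ∈ X :=
  ⟨Unit, ⊥, (), fun _ => X, .of_subsingleton, rfl, fun _ => hX,
    fun _ _ _ hi _ => ⟨.nil, fun _ _ => hi⟩, by simp, fun _ _ h => ⟨(), h⟩⟩

lemma HasRootedDecomp.join {P : Set V → Prop} {X W X' W' : Set V} {E E' : V → V → Prop}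
    (h : HasRootedDecomp P X W E) (h' : HasRootedDecomp P X' W' E') (hW : W ∩ W' ⊆ X ∩ X') :
    HasRootedDecomp P X (W ∪ W') fun u v => E u v ∨ E' u v := by
  obtain ⟨ι, T, r, bag, hT, rfl, hP, hc, hWb, hE⟩ := h
  obtain ⟨ι', T', r', bag', hT', rfl, hP', hc', hWb', hE'⟩ := h'
  let U := T.sum T' ⊔ SimpleGraph.edge (.inl r) (.inr r')
  have hl : T.sum T' ≤ U := le_sup_left
  let L : T →g U := (SimpleGraph.Hom.ofLE hl).comp SimpleGraph.Embedding.sumInl.toHom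
  let R : T' →g U := (SimpleGraph.Hom.ofLE hl).comp SimpleGraph.Embedding.sumInr.toHom
  have hadj : U.Adj (.inl r) (.inr r') := by simp [U, SimpleGraph.edge]
  have hLR : ∀ v i j, v ∈ bag i → v ∈ bag' j →
      ∃ p : U.Walk (.inl i) (.inr j), ∀ x ∈ p.support, v ∈ Sum.elim bag bag' x := by
    intro v i j hi hj
    have hv := hW ⟨(hWb v).2 ⟨i, hi⟩, (hWb' v).2 ⟨j, hj⟩⟩
    obtain ⟨p, hp⟩ := hc v i r hi hv.1
    obtain ⟨q, hq⟩ := hc' v r' j hv.2 hj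
    refine ⟨(p.map L).append (.cons hadj (q.map R)), fun x hx => ?_⟩
    rcases (SimpleGraph.Walk.mem_support_append_iff ..).1 hx with hx | hx
    · obtain ⟨y, hy, rfl⟩ := exists_of_mem_support_map p hx
      exact hp y hy
    · rcases List.mem_cons.1 hx with rfl | hx
      · exact hv.1
      · obtain ⟨y, hy, rfl⟩ := exists_of_mem_support_map q hx
        exact hq y hy
  refine ⟨ι ⊕ ι', U, .inl r, Sum.elim bag bag', isTree_sum_sup_edge hT hT' r r', rfl, ?_, ?_, ?_, ?_⟩
  · rintro (i | i)
    exacts [hP i, hP' i]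
  · rintro v (i | i) (j | j) hi hj
    · obtain ⟨p, hp⟩ := hc v i j hi hj
      refine ⟨p.map L, fun x hx => ?_⟩
      obtain ⟨y, hy, rfl⟩ := exists_of_mem_support_map p hx
      exact hp y hy
    · exact hLR v i j hi hj
    · obtain ⟨p, hp⟩ := hLR v j i hj hi
      exact ⟨p.reverse, fun x hx => hp x (by simpa using hx)⟩
    · obtain ⟨p, hp⟩ := hc' v i j hi hj
      refine ⟨p.map R, fun x hx => ?_⟩
      obtain ⟨y, hy, rfl⟩ := exists_of_mem_support_map p hx
      exact hp y hy
  · intro v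
    rw [mem_union, hWb, hWb']
    simp
  · rintro u v (h | h)
    · obtain ⟨i, hi⟩ := hE u v h
      exact ⟨.inl i, hi⟩
    · obtain ⟨i, hi⟩ := hE' u v h
      exact ⟨.inr i, hi⟩

lemma HasRootedDecomp.exists_treeDecomp {P : Set V → Prop} {X : Set V}
    (h : HasRootedDecomp P X univ G.Adj) : ∃ D : TreeDecomp G, ∀ i, P (D.bag i) := by
  obtain ⟨ι, T, r, bag, hT, -, hP, hc, hW, hE⟩ := h
  refine ⟨⟨ι, T, hT, bag, fun v => ?_, hE⟩, hP⟩
  obtain ⟨i, hi⟩ := (hW v).1 (mem_univ v)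
  refine (SimpleGraph.connected_iff _).2 ⟨fun a b => ?_, ⟨i, hi⟩⟩
  obtain ⟨p, hp⟩ := hc v a b a.2 b.2
  exact ⟨p.induce _ hp⟩

/-- The outer vertex boundary of a set. -/
def outerBoundary (G : SimpleGraph V) (A : Set V) : Set V := {w | w ∉ A ∧ ∃ y ∈ A, G.Adj y w}

/-- The vertex sets obtained by successively eliminating vertices, keeping boundaries small. -/
inductive Eliminable (G : SimpleGraph V) (k : ℕ) : Set V → Prop
  | empty : Eliminable G k ∅
  | union {A B : Set V} : Eliminable G k A → Eliminable G k B → Disjoint A B →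
      (∀ x ∈ A, ∀ y ∈ B, ¬ G.Adj x y) → (outerBoundary G (A ∪ B)).ncard ≤ k + 1 →
      Eliminable G k (A ∪ B)
  | insert {A : Set V} (z : V) : Eliminable G k A → z ∉ A →
      (outerBoundary G A).ncard ≤ k + 1 → (outerBoundary G (insert z A)).ncard ≤ k →
      Eliminable G k (insert z A)

lemma exists_walk_of_connected {ι : Type} {T : SimpleGraph ι} {S : Set ι}
    (h : (T.induce S).Preconnected) {i j : ι} (hi : i ∈ S) (hj : j ∈ S) :
    ∃ p : T.Walk i j, ∀ x ∈ p.support, x ∈ S := by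
  obtain ⟨p⟩ := h ⟨i, hi⟩ ⟨j, hj⟩
  refine ⟨p.map (SimpleGraph.Embedding.induce S).toHom, fun x hx => ?_⟩
  obtain ⟨y, -, rfl⟩ := exists_of_mem_support_map p hx
  exact y.2

/-- In a tree, the gate of a connected set `N` as seen from `s` lies in every connected set that
contains `s` and meets `N`. -/
lemma exists_gate {ι : Type} {T : SimpleGraph ι} (hT : T.IsTree) {N : Set ι} (hne : N.Nonempty)
    (hN : ∀ i ∈ N, ∀ j ∈ N, ∃ p : T.Walk i j, ∀ x ∈ p.support, x ∈ N) (s : ι) :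
    ∃ g ∈ N, ∀ j ∈ N, ∀ p : T.Walk s j, g ∈ p.support := by
  classical
  have hex : ∃ n, ∃ g ∈ N, ∃ p : T.Walk s g, p.length = n :=
    let ⟨g, hg⟩ := hne
    let ⟨p⟩ := hT.connected s g
    ⟨_, g, hg, p, rfl⟩
  obtain ⟨g, hg, p, hp⟩ := Nat.find_spec hex
  have hfirst : ∀ x ∈ p.support, x ∈ N → x = g := by
    intro x hx hxN
    by_contra hne
    have h1 := Nat.find_min' hex ⟨x, hxN, p.takeUntil x hx, rfl⟩
    rw [← hp] at h1
    exact absurd (p.length_takeUntil_lt_length hx hne) (not_lt.2 h1)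
  refine ⟨g, hg, fun j hj q => ?_⟩
  obtain ⟨w, hw⟩ := hN g hg j hj
  have hpath : (p.bypass.append w.bypass).IsPath := by
    rw [SimpleGraph.Walk.isPath_def, SimpleGraph.Walk.support_append, List.nodup_append]
    have h2 := w.bypass_isPath.support_nodup
    rw [← SimpleGraph.Walk.cons_tail_support, List.nodup_cons] at h2
    refine ⟨p.bypass_isPath.support_nodup, h2.2, ?_⟩
    rintro a ha b hb rfl
    have h3 := hfirst a (p.support_bypass_subset_support ha)
      (hw a (w.support_bypass_subset_support (List.mem_of_mem_tail hb)))
    exact h2.1 (h3 ▸ hb)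
  have heq := congrArg Subtype.val
    ((hT.isAcyclic.subsingleton_path _ _).elim ⟨_, hpath⟩ ⟨q.bypass, q.bypass_isPath⟩)
  apply q.support_bypass_subset_support
  rw [← show _ = q.bypass from heq, SimpleGraph.Walk.mem_support_append_iff]
  exact Or.inl (SimpleGraph.Walk.end_mem_support _)

lemma outerBoundary_subset_of_separated {A B : Set V} (hBA : B ⊆ A)
    (h : ∀ x ∈ B, ∀ y ∈ A \ B, ¬ G.Adj x y) : outerBoundary G B ⊆ outerBoundary G A :=
  fun w ⟨hw, y, hy, hyw⟩ => ⟨fun hwA => h y hy w ⟨hwA, hw⟩ hyw, y, hBA hy, hyw⟩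

lemma outerBoundary_diff_singleton_subset (A : Set V) (z : V) :
    outerBoundary G (A \ {z}) ⊆ insert z (outerBoundary G A) := by
  rintro w ⟨hw, y, hy, hyw⟩
  by_cases h : w = z
  · exact Or.inl h
  · exact Or.inr ⟨fun hA => hw ⟨hA, h⟩, y, hy.1, hyw⟩

lemma eliminable_of_subset_bag [Finite V] {k : ℕ} (D : TreeDecomp G)
    (hD : ∀ i, (D.bag i).ncard ≤ k + 1) (A : Set V) (s : D.ι) (hs : outerBoundary G A ⊆ D.bag s) :
    Eliminable G k A := by
  induction h : A.ncard using Nat.strong_induction_on generalizing A s with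
  | _ n ih =>
  subst h
  rcases A.eq_empty_or_nonempty with rfl | ⟨y₀, hy₀⟩
  · exact .empty
  by_cases hsep : ∃ B ⊆ A, B.Nonempty ∧ (A \ B).Nonempty ∧ ∀ x ∈ B, ∀ y ∈ A \ B, ¬ G.Adj x y
  · obtain ⟨B, hBA, ⟨b, hb⟩, ⟨c, hc⟩, hadj⟩ := hsep
    have h1 : Eliminable G k B := ih _ (ncard_lt_ncard ⟨hBA, fun h => hc.2 (h hc.1)⟩ (toFinite _))
      B s ((outerBoundary_subset_of_separated hBA hadj).trans hs) rfl
    have h2 : Eliminable G k (A \ B) :=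
      ih _ (ncard_lt_ncard ⟨sdiff_subset, fun h => (h (hBA hb)).2 hb⟩ (toFinite _)) _ s
        ((outerBoundary_subset_of_separated sdiff_subset fun x hx y hy h =>
          hadj y (by_contra fun h => hy.2 ⟨hy.1, h⟩) x hx h.symm).trans hs) rfl
    have h3 := h1.union h2 disjoint_sdiff_right hadj
    rw [union_sdiff_cancel hBA] at h3
    exact h3 ((ncard_le_ncard hs (toFinite _)).trans (hD s))
  push Not at hsep
  let N : Set D.ι := {i | ∃ y ∈ A, y ∈ D.bag i}
  have hwalk : ∀ v i j, v ∈ D.bag i → v ∈ D.bag j →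
      ∃ p : D.tree.Walk i j, ∀ x ∈ p.support, v ∈ D.bag x := fun v i j hi hj =>
    exists_walk_of_connected (D.vert_conn v).preconnected hi hj
  obtain ⟨i₀, hi₀⟩ := (D.vert_conn y₀).nonempty
  let B : Set V := {y ∈ A | ∀ j, y ∈ D.bag j → ∃ p : D.tree.Walk i₀ j, ∀ x ∈ p.support, x ∈ N}
  have hB : A ⊆ B := by
    by_contra hc
    obtain ⟨c, hc⟩ := not_subset.1 hc
    obtain ⟨x, hx, y, hy, hxy⟩ := hsep B (sep_subset _ _)
      ⟨y₀, hy₀, fun j hj => (hwalk y₀ i₀ j hi₀ hj).imp fun p hp x hx => ⟨y₀, hy₀, hp x hx⟩⟩ ⟨c, hc⟩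
    refine hy.2 ⟨hy.1, fun j hj => ?_⟩
    obtain ⟨i, hxi, hyi⟩ := D.edge_cover x y hxy
    obtain ⟨p, hp⟩ := hx.2 i hxi
    obtain ⟨q, hq⟩ := hwalk y i j hyi hj
    refine ⟨p.append q, fun t ht => ?_⟩
    rw [SimpleGraph.Walk.mem_support_append_iff] at ht
    exact ht.elim (hp t) fun h => ⟨y, hy.1, hq t h⟩
  obtain ⟨g, ⟨z, hzA, hzg⟩, hg⟩ := exists_gate D.isTree (N := N) ⟨i₀, y₀, hy₀, hi₀⟩ (by
    rintro i ⟨y, hy, hyi⟩ j ⟨y', hy', hyj⟩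
    obtain ⟨p, hp⟩ := (hB hy).2 i hyi
    obtain ⟨q, hq⟩ := (hB hy').2 j hyj
    refine ⟨p.reverse.append q, fun t ht => ?_⟩
    rw [SimpleGraph.Walk.mem_support_append_iff, SimpleGraph.Walk.support_reverse,
      List.mem_reverse] at ht
    exact ht.elim (hp t) (hq t)) s
  have hbd : outerBoundary G A ⊆ D.bag g := by
    intro w hw
    obtain ⟨-, y, hy, hyw⟩ := id hw
    obtain ⟨j, hyj, hwj⟩ := D.edge_cover y w hyw
    obtain ⟨p, hp⟩ := hwalk w s j (hs hw) hwj
    exact hp g (hg j ⟨y, hy, hyj⟩ p)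
  have hbd' : outerBoundary G (A \ {z}) ⊆ D.bag g :=
    (outerBoundary_diff_singleton_subset A z).trans (insert_subset hzg hbd)
  have h1 : Eliminable G k (A \ {z}) :=
    ih _ (ncard_sdiff_singleton_lt_of_mem hzA (toFinite _)) _ g hbd' rfl
  have h2 := h1.insert z (by simp) ((ncard_le_ncard hbd' (toFinite _)).trans (hD g))
  rw [insert_sdiff_singleton, insert_eq_of_mem hzA] at h2
  refine h2 ?_
  have h3 : (outerBoundary G A).ncard < (D.bag g).ncard :=
    ncard_lt_ncard ⟨hbd, fun h => (h hzg).1 hzA⟩ (toFinite _)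
  have := hD g
  omega

/-- The greedy basis on the inside of the cut around `A`. -/
def innerBasis (G : SimpleGraph V) (ρ : V → ℕ) (A : Set V) : Set V := greedyBasis G ρ A Aᶜ

/-- The greedy basis on the outside of the cut around `A`. -/
def outerBasis (G : SimpleGraph V) (ρ : V → ℕ) (A : Set V) : Set V := greedyBasis G ρ Aᶜ A

section Cut

variable {ρ : V → ℕ} {A D : Set V}

lemma innerBasis_subset : innerBasis G ρ A ⊆ A := greedyBasis_subset _ _ _

lemma outerBasis_subset : outerBasis G ρ A ⊆ outerBoundary G A := fun _ hw =>
  ⟨hw.1, (exists_adj_of_mem_greedyBasis hw).imp fun _ h => ⟨h.1, h.2.symm⟩⟩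

lemma innerBasis_anti (h : A ⊆ D) {x : V} (hx : x ∈ innerBasis G ρ D) (hxA : x ∈ A) :
    x ∈ innerBasis G ρ A :=
  greedyBasis_anti (fun _ _ _ _ => id) h (compl_subset_compl.2 h) ⟨hx, hxA⟩

lemma outerBasis_mono (h : A ⊆ D) {x : V} (hx : x ∈ outerBasis G ρ A) (hxD : x ∉ D) :
    x ∈ outerBasis G ρ D :=
  greedyBasis_anti (fun _ _ _ _ => id) (compl_subset_compl.2 h) h ⟨hx, hxD⟩

lemma mem_outerBasis_of_notMem_innerBasis [Finite V] {x w : V} (hx : x ∈ A) (hw : w ∉ A)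
    (h : G.Adj x w) (hxI : x ∉ innerBasis G ρ A) : w ∈ outerBasis G ρ A :=
  (mem_greedyBasis_or hx hw h).resolve_left hxI

lemma matchedSet_cut [Finite V] {ρ' : V → ℕ} (hρ : ρ.Injective) (hρ' : ρ'.Injective) (A : Set V) :
    MatchedSet G (innerBasis G ρ A ∪ outerBasis G ρ' A) :=
  Or.inl <| (exists_isMatching_greedyBasis hρ hρ' disjoint_compl_right).imp fun _ h => h.symm

lemma ncard_cut [Finite V] {ρ' : V → ℕ} (hρ : ρ.Injective) (hρ' : ρ'.Injective) (A : Set V) :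
    (innerBasis G ρ A ∪ outerBasis G ρ' A).ncard = 2 * (outerBasis G ρ' A).ncard := by
  rw [innerBasis, outerBasis, ncard_union_eq (disjoint_compl_right.mono (greedyBasis_subset _ _ _)
    (greedyBasis_subset _ _ _)), ncard_greedyBasis hρ hρ', two_mul]

lemma ncard_outerBasis_le [Finite V] : (outerBasis G ρ A).ncard ≤ (outerBoundary G A).ncard :=
  ncard_le_ncard outerBasis_subset (toFinite _)

/-- A set that exceeds a matched set by at most one vertex is matched, provided that the extra
vertex has a neighbor. -/
lemma matchedSet_of_insert {C S : Set V} {v : V} {M : G.Subgraph} (hM : M.IsMatching)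
    (hMS : M.verts = S) (hv : v ∉ S) (hC : C = insert v S) {u : V} (hu : u ∈ C)
    (hvu : G.Adj v u) : MatchedSet G C := by
  subst hC
  refine Or.inr ⟨M, v, hM, mem_insert _ _, ?_, u, ?_, hvu⟩
  · rw [hMS, insert_sdiff_of_mem _ (mem_singleton v), sdiff_singleton_eq_self hv]
  · exact hMS ▸ hu.resolve_left hvu.ne'

/-- The bag used when the vertex `z` is eliminated after `A`. -/
lemma matchedSet_insert_step [Finite V] (hρ : ρ.Injective) (hiso : ∀ v, ∃ u, G.Adj v u) {z : V}
    (hz : z ∉ A) :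
    MatchedSet G (innerBasis G ρ A ∪ insert z (outerBasis G ρ (insert z A))) := by
  set I := innerBasis G ρ A
  set O := outerBasis G ρ A
  set I' := innerBasis G ρ (insert z A)
  set O' := outerBasis G ρ (insert z A)
  set C := I ∪ insert z O'
  have hIA : I ⊆ A := innerBasis_subset
  have hOz : O ⊆ insert z O' := fun w hw => by
    by_cases h : w = z
    · exact Or.inl h
    · exact Or.inr (outerBasis_mono (subset_insert _ _) hw fun h' => h'.elim h hw.1)
  have hIz : I' ⊆ insert z I := fun w hw => by
    rcases hw.1 with h | h
    · exact Or.inl h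
    · exact Or.inr (innerBasis_anti (subset_insert _ _) hw h)
  have hWC : I ∪ O ⊆ C := union_subset_union_right _ hOz
  have hWC' : I' ∪ O' ⊆ C := union_subset
    (hIz.trans (insert_subset (Or.inr (Or.inl rfl)) subset_union_left))
    ((subset_insert _ _).trans subset_union_right)
  have hzO' : z ∉ O' := fun h => h.1 (Or.inl rfl)
  have hCcard : C.ncard = O.ncard + O'.ncard + 1 := by
    rw [ncard_union_eq, ncard_insert_of_notMem hzO']
    · rw [show I.ncard = O.ncard from ncard_greedyBasis hρ hρ _ _, add_assoc]
    · rw [disjoint_left]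
      rintro x hx (rfl | hx')
      · exact hz (hIA hx)
      · exact hx'.1 (Or.inr (hIA hx))
  have hW : (I ∪ O).ncard = 2 * O.ncard := ncard_cut hρ hρ A
  have hW' : (I' ∪ O').ncard = 2 * O'.ncard := ncard_cut hρ hρ (insert z A)
  by_cases h1 : I ∪ O = C
  · exact h1 ▸ matchedSet_cut hρ hρ A
  by_cases h2 : I' ∪ O' = C
  · exact h2 ▸ matchedSet_cut hρ hρ _
  have hlt : (I ∪ O).ncard < C.ncard := ncard_lt_ncard (hWC.ssubset_of_ne h1) (toFinite _)
  have hlt' : (I' ∪ O').ncard < C.ncard := ncard_lt_ncard (hWC'.ssubset_of_ne h2) (toFinite _)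
  obtain ⟨v, hv⟩ : ∃ v, C \ (I ∪ O) = {v} := by
    rw [← ncard_eq_one, ncard_sdiff hWC (toFinite _)]
    omega
  have hvm : v ∈ C \ (I ∪ O) := hv ▸ rfl
  have hCv : C = insert v (I ∪ O) := by
    rw [← sdiff_union_of_subset hWC, hv, singleton_union]
  obtain ⟨M, hMv, hM⟩ := exists_isMatching_greedyBasis (G := G) hρ hρ (disjoint_compl_right (a := A))
  suffices h : ∃ u ∈ C, G.Adj v u by
    obtain ⟨u, hu, hvu⟩ := h
    exact matchedSet_of_insert hM hMv hvm.2 hCv hu hvu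
  rcases hvm.1 with hvI | rfl | hvO
  · exact absurd (Or.inl hvI) hvm.2
  · by_cases hvI' : v ∈ I'
    · obtain ⟨f, -, hf⟩ := exists_injOn_greedyBasis (G := G) hρ ρ (insert v A) (insert v A)ᶜ
      exact ⟨f v, hWC' (Or.inr (hf v hvI').1), (hf v hvI').2⟩
    · obtain ⟨u, hu⟩ := hiso v
      refine ⟨u, ?_, hu⟩
      by_cases huA : u ∈ A
      · by_contra huC
        exact hvm.2 (Or.inr (mem_outerBasis_of_notMem_innerBasis huA hz hu.symm
          fun h => huC (Or.inl h)))
      · refine hWC' (Or.inr (mem_outerBasis_of_notMem_innerBasis (Or.inl rfl) ?_ hu hvI'))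
        exact fun h => h.elim hu.ne' huA
  · obtain ⟨f, -, hf⟩ := exists_injOn_greedyBasis (G := G) hρ ρ (insert z A)ᶜ (insert z A)
    exact ⟨f v, hWC' (Or.inl (hf v hvO).1), (hf v hvO).2⟩

/-- The inner basis of a union of separated sets can be chosen to extend that of one part. -/
lemma exists_extended_order [Finite V] (hρ : ρ.Injective) (hAD : A ⊆ D)
    (hsep : ∀ x ∈ A, ∀ y ∈ D \ A, ¬ G.Adj x y) : ∃ ρ' : V → ℕ, ρ'.Injective ∧
      innerBasis G ρ A ⊆ innerBasis G ρ' D ∧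
      innerBasis G ρ' D ⊆ innerBasis G ρ A ∪ innerBasis G ρ D := by
  classical
  have := Fintype.ofFinite V
  obtain ⟨N, hN⟩ : ∃ N, ∀ v, ρ v < N :=
    ⟨Finset.univ.sup ρ + 1, fun v => Nat.lt_succ_of_le (Finset.le_sup (Finset.mem_univ v))⟩
  let ρ' : V → ℕ := fun v => if v ∈ A then ρ v else ρ v + N
  have hin : ∀ v, v ∈ A → ρ' v = ρ v := fun v h => if_pos h
  have hout : ∀ v, v ∉ A → ρ' v = ρ v + N := fun v h => if_neg h
  refine ⟨ρ', fun a b hab => ?_, fun x hx => ⟨hAD hx.1, fun h => hx.2 ?_⟩, fun x hx => ?_⟩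
  · have ha := hN a
    have hb := hN b
    by_cases h1 : a ∈ A <;> by_cases h2 : b ∈ A <;>
      simp only [hin, hout, h1, h2, not_false_eq_true] at hab
    · exact hρ hab
    · omega
    · omega
    · exact hρ (by omega)
  · have hsub : {y ∈ D | ρ' y < ρ' x} ⊆ {y ∈ A | ρ y < ρ x} := by
      rintro y ⟨-, hy⟩
      rw [hin x hx.1] at hy
      by_cases hyA : y ∈ A
      · exact ⟨hyA, hin y hyA ▸ hy⟩
      · rw [hout y hyA] at hy
        have := hN x
        omega
    obtain ⟨Y, g, hYU, hg, hgS, hN, hR⟩ := h.mono hsub subset_rfl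
    have hcut : ∀ a ∈ A, ∀ u ∈ Aᶜ, G.Adj a u → u ∈ Dᶜ := fun a ha u hu h huD =>
      hsep a ha u ⟨huD, hu⟩ h
    refine ⟨Y, g, hYU.trans (compl_subset_compl.2 hAD), hg, hgS, fun y hy u hu h => ?_, ?_⟩
    · exact hN y hy u (hcut _ (hgS y hy).1.1 u hu h) h
    · rintro _ rfl u hu h
      exact hR _ rfl u (hcut _ hx.1 u hu h) h
  · by_cases hxA : x ∈ A
    · refine Or.inl (greedyBasis_anti (fun a ha b hb hab => ?_) hAD (compl_subset_compl.2 hAD)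
        ⟨hx, hxA⟩)
      rwa [hin a ha, hin b hb]
    · refine Or.inr ⟨hx.1, fun h => hx.2 (h.mono (fun y hy => ⟨hy.1, ?_⟩) subset_rfl)⟩
      have h1 := hN y
      have h2 := hy.2
      rw [hout x hxA]
      by_cases hyA : y ∈ A
      · rw [hin y hyA]
        omega
      · rw [hout y hyA]
        omega

end Cut

/-- The edges that a decomposition of the part inside `A` has to cover. -/
def CutEdge (G : SimpleGraph V) (ρ : V → ℕ) (A : Set V) (y w : V) : Prop :=
  y ∈ A ∧ G.Adj y w ∧ (w ∈ A ∨ y ∉ innerBasis G ρ A)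

/-- Bags that are matched and have at most `2 * k + 2` vertices. -/
def GoodBag (G : SimpleGraph V) (k : ℕ) (S : Set V) : Prop :=
  MatchedSet G S ∧ S.ncard ≤ 2 * k + 2

/-- There is a good decomposition of the part of the graph inside `A`. -/
def CutDecomp (G : SimpleGraph V) (ρ : V → ℕ) (k : ℕ) (A : Set V) : Prop :=
  HasRootedDecomp (GoodBag G k) (innerBasis G ρ A ∪ outerBasis G ρ A) (A ∪ outerBasis G ρ A)
    (CutEdge G ρ A)

section Decomp

variable [Finite V] {ρ : V → ℕ} {k : ℕ} {A D : Set V}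

lemma goodBag_cut {ρ' : V → ℕ} (hρ : ρ.Injective) (hρ' : ρ'.Injective)
    (hA : (outerBoundary G A).ncard ≤ k + 1) :
    GoodBag G k (innerBasis G ρ A ∪ outerBasis G ρ' A) := by
  refine ⟨matchedSet_cut hρ hρ' A, ?_⟩
  rw [ncard_cut hρ hρ']
  have := ncard_outerBasis_le (G := G) (ρ := ρ') (A := A)
  omega

lemma CutDecomp.link (hρ : ρ.Injective) (h : CutDecomp G ρ k A) (hAD : A ⊆ D)
    (hsep : ∀ x ∈ A, ∀ y ∈ D \ A, ¬ G.Adj x y) (hD : (outerBoundary G D).ncard ≤ k + 1) :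
    HasRootedDecomp (GoodBag G k) (innerBasis G ρ D ∪ outerBasis G ρ D)
      (A ∪ (innerBasis G ρ D ∪ outerBasis G ρ D))
      fun y w => y ∈ A ∧ G.Adj y w ∧ (w ∈ A ∨ y ∉ innerBasis G ρ D) := by
  obtain ⟨ρ', hρ', hsub, hsup⟩ := exists_extended_order hρ hAD hsep
  have hOA : ∀ w ∈ outerBasis G ρ A, w ∉ D := fun w hw hwD => by
    obtain ⟨hwA, y, hy, hyw⟩ := outerBasis_subset hw
    exact hsep y hy w ⟨hwD, hwA⟩ hyw
  have hOAD : outerBasis G ρ A ⊆ outerBasis G ρ D := fun w hw => outerBasis_mono hAD hw (hOA w hw)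
  have hID : innerBasis G ρ D ⊆ D := innerBasis_subset
  have hIA : innerBasis G ρ A ⊆ A := innerBasis_subset
  have hOD : ∀ w ∈ outerBasis G ρ D, w ∉ D := fun w hw => hw.1
  have h1 := (HasRootedDecomp.single (goodBag_cut hρ' hρ hD)).join h (by
    rintro v ⟨hv | hv, hvA | hvA⟩
    · refine ⟨Or.inl hv, Or.inl ?_⟩
      exact (hsup hv).elim id fun h => innerBasis_anti hAD h hvA
    · exact absurd (innerBasis_subset hv) (hOA v hvA)
    · exact absurd (hAD hvA) (hOD v hv)
    · exact ⟨Or.inr hv, Or.inr hvA⟩)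
  have h2 := (HasRootedDecomp.single (goodBag_cut hρ hρ hD)).join h1 (by
    rintro v ⟨hv | hv, hv'⟩
    · refine ⟨Or.inl hv, ?_⟩
      rcases hv' with hv' | hv' | hv'
      · exact hv'
      · exact Or.inl (hsub (innerBasis_anti hAD hv hv'))
      · exact absurd (hID hv) (hOA v hv')
    · exact ⟨Or.inr hv, Or.inr hv⟩)
  refine h2.mono ?_ fun y w ⟨hy, hyw, hyI⟩ => Or.inl (Or.inr ?_)
  · ext v
    constructor
    · rintro (hv | (hv | hv) | hv | hv)
      · exact Or.inr hv
      · exact (hsup hv).elim (fun h => Or.inl (hIA h)) fun h => Or.inr (Or.inl h)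
      · exact Or.inr (Or.inr hv)
      · exact Or.inl hv
      · exact Or.inr (Or.inr (hOAD hv))
    · rintro (hv | hv)
      · exact Or.inr (Or.inr (Or.inl hv))
      · exact Or.inl hv
  · by_cases hwA : w ∈ A
    · exact Or.inr ⟨hy, hyw, Or.inl hwA⟩
    by_cases hyA : y ∈ innerBasis G ρ A
    · refine Or.inl ⟨Or.inl (hsub hyA), Or.inr ?_⟩
      exact mem_outerBasis_of_notMem_innerBasis (hAD hy) (fun h => hsep y hy w ⟨h, hwA⟩ hyw) hyw
        (hyI.resolve_left hwA)
    · exact Or.inr ⟨hy, hyw, Or.inr hyA⟩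

lemma CutDecomp.union (hρ : ρ.Injective) {B : Set V} (hA : CutDecomp G ρ k A)
    (hB : CutDecomp G ρ k B) (hAB : Disjoint A B) (hsep : ∀ x ∈ A, ∀ y ∈ B, ¬ G.Adj x y)
    (hD : (outerBoundary G (A ∪ B)).ncard ≤ k + 1) : CutDecomp G ρ k (A ∪ B) := by
  have h1 := hA.link hρ subset_union_left (fun x hx y hy => hsep x hx y (hy.1.resolve_left hy.2)) hD
  have h2 := hB.link hρ subset_union_right
    (fun x hx y hy h => hsep y (hy.1.resolve_right hy.2) x hx h.symm) hD
  have hID : innerBasis G ρ (A ∪ B) ⊆ A ∪ B := innerBasis_subset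
  refine (h1.join h2 ?_).mono ?_ ?_
  · rintro v ⟨hv | hv, hv' | hv'⟩
    · exact absurd hv' (disjoint_left.1 hAB hv)
    · exact ⟨hv', hv'⟩
    · exact ⟨hv, hv⟩
    · exact ⟨hv, hv⟩
  · ext v
    have := @hID v
    simp only [mem_union] at this ⊢
    tauto
  · rintro y w ⟨hy | hy, hyw, h⟩
    · exact Or.inl (Or.inl ⟨hy, hyw,
        h.imp_left fun hw => hw.resolve_right fun hw => hsep y hy w hw hyw⟩)
    · exact Or.inl (Or.inr ⟨hy, hyw,
        h.imp_left fun hw => hw.resolve_left fun hw => hsep w hw y hy hyw.symm⟩)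

lemma CutDecomp.insert_vertex (hρ : ρ.Injective) (hiso : ∀ v, ∃ u, G.Adj v u)
    (h : CutDecomp G ρ k A) {z : V} (hz : z ∉ A) (hA : (outerBoundary G A).ncard ≤ k + 1)
    (hzA : (outerBoundary G (insert z A)).ncard ≤ k) : CutDecomp G ρ k (insert z A) := by
  have hIA : innerBasis G ρ A ⊆ A := innerBasis_subset
  have hsub : A ⊆ insert z A := subset_insert _ _
  have hO' : ∀ w ∈ outerBasis G ρ (insert z A), w ∉ insert z A := fun w hw => hw.1
  have hOz : outerBasis G ρ A ⊆ insert z (outerBasis G ρ (insert z A)) := fun w hw => by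
    by_cases h : w = z
    · exact Or.inl h
    · exact Or.inr (outerBasis_mono hsub hw fun h' => h'.elim h hw.1)
  have hIz : innerBasis G ρ (insert z A) ⊆ insert z (innerBasis G ρ A) := fun w hw => by
    rcases hw.1 with h | h
    · exact Or.inl h
    · exact Or.inr (innerBasis_anti hsub hw h)
  have hgood : GoodBag G k (innerBasis G ρ A ∪ insert z (outerBasis G ρ (insert z A))) := by
    refine ⟨matchedSet_insert_step hρ hiso hz, ?_⟩
    have h1 : (innerBasis G ρ A).ncard = (outerBasis G ρ A).ncard := ncard_greedyBasis hρ hρ _ _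
    have h2 := ncard_outerBasis_le (G := G) (ρ := ρ) (A := A)
    have h3 := ncard_outerBasis_le (G := G) (ρ := ρ) (A := insert z A)
    have h4 := ncard_union_le (innerBasis G ρ A) (insert z (outerBasis G ρ (insert z A)))
    have h5 := ncard_insert_le z (outerBasis G ρ (insert z A))
    omega
  have hmem : ∀ w ∉ insert z A, ∀ y ∈ insert z A, G.Adj y w →
      y ∉ innerBasis G ρ (insert z A) → w ∈ outerBasis G ρ (insert z A) := fun w hw y hy hyw hyI =>
    mem_outerBasis_of_notMem_innerBasis hy hw hyw hyI
  have h1 := (HasRootedDecomp.single hgood).join h (by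
    rintro v ⟨hv | hv, hv' | hv'⟩
    · exact ⟨Or.inl hv, Or.inl hv⟩
    · exact ⟨Or.inl hv, Or.inl hv⟩
    · rcases hv with rfl | hv
      · exact absurd hv' hz
      · exact absurd (hsub hv') (hO' v hv)
    · exact ⟨Or.inr hv, Or.inr hv'⟩)
  have hroot : innerBasis G ρ (insert z A) ∪ outerBasis G ρ (insert z A) ⊆
      innerBasis G ρ A ∪ insert z (outerBasis G ρ (insert z A)) := by
    rintro v (hv | hv)
    · exact (hIz hv).elim (fun h => Or.inr (Or.inl h)) Or.inl
    · exact Or.inr (Or.inr hv)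
  have h2 := (HasRootedDecomp.single
    (goodBag_cut hρ hρ (hzA.trans (Nat.le_succ k)))).join h1 fun v hv => ⟨hv.1, hroot hv.1⟩
  refine h2.mono ?_ ?_
  · ext v
    have ha := @hroot v
    have hb := @hOz v
    have hc := @hIA v
    simp only [mem_union, mem_insert_iff] at ha hb hc ⊢
    tauto
  · rintro y w ⟨rfl | hy, hyw, hyI⟩
    · by_cases hwA : w ∈ A
      · refine Or.inr (Or.inr ?_)
        by_cases hwI : w ∈ innerBasis G ρ A
        · exact Or.inl ⟨Or.inl hwI, Or.inr (Or.inl rfl)⟩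
        · exact Or.inr ⟨hwA, hyw.symm, Or.inr hwI⟩
      · have hw : w ∉ insert y A := fun h => h.elim hyw.ne' hwA
        exact Or.inl (Or.inr (Or.inl ⟨Or.inr (Or.inl rfl),
          Or.inr (Or.inr (hmem w hw y (Or.inl rfl) hyw (hyI.resolve_left hw)))⟩))
    · refine Or.inl (Or.inr ?_)
      by_cases hwA : w ∈ A
      · exact Or.inr ⟨hy, hyw, Or.inl hwA⟩
      by_cases hyA : y ∈ innerBasis G ρ A
      · refine Or.inl ⟨Or.inl hyA, Or.inr ?_⟩
        by_cases hwz : w = z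
        · exact Or.inl hwz
        · have hw : w ∉ insert z A := fun h => h.elim hwz hwA
          exact Or.inr (hmem w hw y (Or.inr hy) hyw (hyI.resolve_left hw))
      · exact Or.inr ⟨hy, hyw, Or.inr hyA⟩

lemma CutDecomp.empty (hρ : ρ.Injective) : CutDecomp G ρ k ∅ := by
  have hO : outerBasis G ρ ∅ = ∅ := by
    refine eq_empty_of_forall_notMem fun w hw => ?_
    obtain ⟨-, y, hy, -⟩ := outerBasis_subset hw
    exact hy
  have hI : innerBasis G ρ ∅ = ∅ := subset_empty_iff.1 innerBasis_subset
  refine (HasRootedDecomp.single (goodBag_cut hρ hρ ?_)).mono ?_ ?_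
  · simp [outerBoundary]
  · rw [hI, hO]
  · rintro y w ⟨hy, -⟩
    exact absurd hy (notMem_empty y)

lemma Eliminable.cutDecomp (hρ : ρ.Injective) (hiso : ∀ v, ∃ u, G.Adj v u)
    (h : Eliminable G k A) : CutDecomp G ρ k A := by
  induction h with
  | empty => exact .empty hρ
  | union _ _ hAB hsep hD ihA ihB => exact ihA.union hρ ihB hAB hsep hD
  | insert z _ hz hA hzA ih => exact ih.insert_vertex hρ hiso hz hA hzA

end Decomp

lemma exists_adj_of_mem_of_matchedSet {S : Set V} (hS : MatchedSet G S) {v : V} (hv : v ∈ S) :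
    ∃ u, G.Adj v u := by
  have key : ∀ M : G.Subgraph, M.IsMatching → v ∈ M.verts → ∃ u, G.Adj v u := fun M hM h =>
    (hM h).exists.imp fun _ => M.adj_sub
  rcases hS with ⟨M, hM, rfl⟩ | ⟨M, x, hM, -, hMS, u, -, hxu⟩
  · exact key M hM hv
  · by_cases h : v = x
    · exact ⟨u, h ▸ hxu⟩
    · exact key M hM (hMS ▸ ⟨hv, h⟩)

theorem exists_isMatched_of_width_le [Finite V] {k : ℕ} (hiso : ∀ v, ∃ u, G.Adj v u)
    (D : TreeDecomp G) (hD : ∀ i, (D.bag i).ncard ≤ k + 1) :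
    ∃ D' : TreeDecomp G, D'.IsMatched ∧ ∀ i, (D'.bag i).ncard ≤ 2 * k + 2 := by
  obtain ⟨n, ⟨e⟩⟩ := Finite.exists_equiv_fin V
  let ρ : V → ℕ := fun v => e v
  have hρ : ρ.Injective := Fin.val_injective.comp e.injective
  obtain ⟨s⟩ := D.isTree.connected.nonempty
  have h := (eliminable_of_subset_bag D hD univ s fun w hw =>
    absurd (mem_univ w) hw.1).cutDecomp hρ hiso
  have h' : HasRootedDecomp (GoodBag G k) _ univ G.Adj :=
    HasRootedDecomp.mono h (by simp) fun u v huv => Or.inl ⟨mem_univ u, huv, Or.inl (mem_univ v)⟩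
  obtain ⟨D', hD'⟩ := h'.exists_treeDecomp
  exact ⟨D', fun i => (hD' i).1, fun i => (hD' i).2⟩

end MatchedTreewidth

/-- For any graph `G`, `mtw G ≤ 2 · tw G + 1`. -/
theorem stmt5 {V : Type} [Fintype V] (G : SimpleGraph V) :
    mtw G ≤ 2 * treewidth G + 1 := by
  rcases Set.eq_empty_or_nonempty
    {k | ∃ D : TreeDecomp G, D.IsMatched ∧ ∀ i, (D.bag i).ncard ≤ k + 1} with h | ⟨k, D, hD, hk⟩
  · rw [mtw, h, Nat.sInf_empty]
    exact Nat.zero_le _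
  have hiso : ∀ v, ∃ u, G.Adj v u := fun v =>
    let ⟨i, hi⟩ := (D.vert_conn v).nonempty
    MatchedTreewidth.exists_adj_of_mem_of_matchedSet (hD i) hi
  obtain ⟨D', hD'⟩ : ∃ D : TreeDecomp G, ∀ i, (D.bag i).ncard ≤ treewidth G + 1 :=
    Nat.sInf_mem (s := {k | ∃ D : TreeDecomp G, ∀ i, (D.bag i).ncard ≤ k + 1}) ⟨k, D, hk⟩
  exact Nat.sInf_le (MatchedTreewidth.exists_isMatched_of_width_le hiso D' hD')
end

section
/- For any graph G, the matched treewidth of G is at most mtd(G) + 1, where mtd(G) is the matched treedepth of G. In particular, matched treewidth is finite for every graph. -/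
open SimpleGraph

/-- An elimination tree (forest) of a graph `G`, encoded via its strict
ancestor relation `anc`: ancestors of each vertex form a chain, every edge of
`G` joins comparable vertices, and the vertex set of every subtree induces a
connected subgraph (so the subtrees of any node are exactly the connected
components left after deleting the node and its ancestors, as in the
recursive definition). -/
structure ElimTree {V : Type} (G : SimpleGraph V) where
  anc : V → V → Prop
  trans : ∀ a b c, anc a b → anc b c → anc a c
  irrefl : ∀ a, ¬ anc a a
  chainAnc : ∀ a b c, anc a c → anc b c → a = b ∨ anc a b ∨ anc b a
  edgeComp : ∀ u v, G.Adj u v → anc u v ∨ anc v u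
  subtreeConn : ∀ v, (G.induce {w | w = v ∨ anc v w}).Connected

/-- Depth: maximum number of vertices on a root-to-leaf path. -/
noncomputable def ElimTree.depth {V : Type} [Fintype V] {G : SimpleGraph V}
    (T : ElimTree G) : ℕ :=
  Finset.univ.sup fun v => {u | T.anc u v}.ncard + 1

/-- Treedepth: minimum depth of an elimination tree. -/
noncomputable def treedepth {V : Type} [Fintype V] (G : SimpleGraph V) : ℕ :=
  sInf {d | ∃ T : ElimTree G, T.depth = d}

/-- The matched condition on a root-to-leaf path `(v₁, …, v_k)` (as a list):
if `k` is even, the pairs `v₁v₂, v₃v₄, …, v_{k-1}v_k` are edges (a matching);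
if `k` is odd, there is a position `p` (0-based, odd) such that consecutive
pairs form edges, with the vertex at position `p` used twice. -/
def MatchedList {V : Type} (G : SimpleGraph V) (l : List V) : Prop :=
  (Even l.length ∧ ∀ (j : ℕ) (h : 2 * j + 1 < l.length),
      G.Adj (l.get ⟨2 * j, by omega⟩) (l.get ⟨2 * j + 1, h⟩)) ∨
  (Odd l.length ∧ ∃ p : ℕ, Odd p ∧ ∃ _hp : p + 1 < l.length,
      (∀ (j : ℕ) (_h : 2 * j + 1 ≤ p),
        G.Adj (l.get ⟨2 * j, by omega⟩) (l.get ⟨2 * j + 1, by omega⟩)) ∧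
      (∀ (b : ℕ) (h : p + 2 * b + 1 < l.length),
        G.Adj (l.get ⟨p + 2 * b, by omega⟩) (l.get ⟨p + 2 * b + 1, h⟩)))

/-- A matched elimination tree: every root-to-leaf path (enumerated in order
from the root) satisfies the matched condition. -/
def ElimTree.IsMatched {V : Type} {G : SimpleGraph V} (T : ElimTree G) : Prop :=
  ∀ v : V, (∀ w, ¬ T.anc v w) →
    ∀ l : List V, l.Pairwise T.anc → (∀ u, u ∈ l ↔ (T.anc u v ∨ u = v)) →
      MatchedList G l

/-- Matched treedepth: minimum depth of a matched elimination tree. -/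
noncomputable def mtd {V : Type} [Fintype V] (G : SimpleGraph V) : ℕ :=
  sInf {d | ∃ T : ElimTree G, T.IsMatched ∧ T.depth = d}

namespace SimpleGraph

theorem isTree_pathGraph (n : ℕ) : (pathGraph (n + 1)).IsTree := by
  have hconn := pathGraph_connected n
  rw [isTree_iff_connected_and_card]
  refine ⟨hconn, le_antisymm ?_ hconn.card_vert_le_card_edgeSet_add_one⟩
  have hsub : (pathGraph (n + 1)).edgeSet ⊆
      Set.range fun i : Fin n => s(i.castSucc, i.succ) := by
    intro e
    induction e with
    | _ u v =>
      rw [mem_edgeSet, pathGraph_adj]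
      rintro (h | h)
      · refine ⟨⟨u, by omega⟩, ?_⟩
        rw [Sym2.eq_iff]
        exact Or.inl ⟨Fin.ext rfl, Fin.ext (by simpa using h)⟩
      · refine ⟨⟨v, by omega⟩, ?_⟩
        rw [Sym2.eq_iff]
        exact Or.inr ⟨Fin.ext rfl, Fin.ext (by simpa using h)⟩
  have hcard : Nat.card (pathGraph (n + 1)).edgeSet ≤ n := by
    calc Nat.card (pathGraph (n + 1)).edgeSet
        ≤ Nat.card (Set.range fun i : Fin n => s(i.castSucc, i.succ)) :=
          Nat.card_mono (Set.toFinite _) hsub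
      _ ≤ Nat.card (Fin n) := Finite.card_range_le _
      _ = n := by simp
  simpa using hcard

theorem connected_induce_pathGraph {n : ℕ} {s : Set (Fin n)} (hs : s.OrdConnected)
    (hne : s.Nonempty) : ((pathGraph n).induce s).Connected := by
  have key : ∀ (k : ℕ) (i j : s), i.1.val + k = j.1.val →
      ((pathGraph n).induce s).Reachable i j := by
    intro k
    induction k with
    | zero =>
      intro i j h
      obtain rfl : i = j := Subtype.ext (Fin.ext (by simpa using h))
      exact Reachable.refl _
    | succ k ih =>
      intro i j h
      have hmem : (⟨i.1.val + k, by omega⟩ : Fin n) ∈ s :=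
        hs.out i.2 j.2 ⟨Fin.le_def.2 (by simp), Fin.le_def.2 (by simp; omega)⟩
      refine (ih i ⟨_, hmem⟩ rfl).trans (Adj.reachable ?_)
      rw [comap_adj, pathGraph_adj]
      left
      simp only [Function.Embedding.subtype_apply]
      omega
  have := hne.to_subtype
  refine ⟨fun i j => ?_⟩
  rcases le_total i.1.val j.1.val with h | h
  · exact key (j.1.val - i.1.val) i j (by omega)
  · exact (key (i.1.val - j.1.val) j i (by omega)).symm

end SimpleGraph

theorem exists_isMatching_of_list {V : Type} {G : SimpleGraph V} :
    ∀ (n : ℕ) (l : List V), l.length = 2 * n → l.Nodup →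
      (∀ (j : ℕ) (h : 2 * j + 1 < l.length), G.Adj l[2 * j] l[2 * j + 1]) →
      ∃ M : G.Subgraph, M.IsMatching ∧ M.verts = {x | x ∈ l} := by
  intro n
  induction n with
  | zero =>
    intro l hl _ _
    obtain rfl := List.length_eq_zero_iff.1 hl
    exact ⟨⊥, by simp [Subgraph.IsMatching], by simp⟩
  | succ n ih =>
    intro l hl hnd hadj
    match l, hl, hnd, hadj with
    | a :: b :: t, hl, hnd, hadj =>
      simp only [List.nodup_cons, List.mem_cons, not_or] at hnd
      obtain ⟨M, hM, hv⟩ := ih t (by simp at hl; omega) hnd.2.2 fun j h => by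
        simpa [Nat.mul_add] using hadj (j + 1) (by simp; omega)
      have hab : G.Adj a b := by simpa using hadj 0 (by simp)
      refine ⟨G.subgraphOfAdj hab ⊔ M, (Subgraph.IsMatching.subgraphOfAdj hab).sup hM ?_, ?_⟩
      · rw [hM.support_eq_verts, (Subgraph.IsMatching.subgraphOfAdj hab).support_eq_verts, hv,
          Set.disjoint_left]
        rintro x (rfl | rfl) hx
        · exact hnd.1.2 hx
        · exact hnd.2.1 hx
      · ext x
        simp [hv, or_assoc]

theorem MatchedList.matchedSet {V : Type} {G : SimpleGraph V} {l : List V}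
    (h : MatchedList G l) (hnd : l.Nodup) : MatchedSet G {x | x ∈ l} := by
  rcases h with ⟨⟨n, hn⟩, h⟩ | ⟨⟨n, hn⟩, p, ⟨q, hq⟩, hp, h₁, h₂⟩
  · exact Or.inl (exists_isMatching_of_list n l (by omega) hnd h)
  · right
    subst hq
    obtain ⟨M, hM, hv⟩ := exists_isMatching_of_list (q + 1) (l.take (2 * q + 2))
      (by rw [List.length_take]; omega) (hnd.sublist (List.take_sublist _ _)) fun j hj => by
        rw [List.length_take] at hj
        simpa using h₁ j (by omega)
    obtain ⟨M', hM', hv'⟩ := exists_isMatching_of_list (n - q - 1) (l.drop (2 * q + 3))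
      (by rw [List.length_drop]; omega) (hnd.sublist (List.drop_sublist _ _)) fun j hj => by
        rw [List.length_drop] at hj
        have := h₂ (j + 1) (by omega)
        rw [List.getElem_drop, List.getElem_drop]
        convert this using 2
        · simp; congr 1; omega
        · simp; congr 1; omega
    have hsplit : l = l.take (2 * q + 2) ++ l[2 * q + 2] :: l.drop (2 * q + 3) := by
      rw [← List.drop_eq_getElem_cons, List.take_append_drop]
    have hnd' := hnd
    rw [hsplit, List.nodup_append] at hnd'
    obtain ⟨-, hnd₂, hnd₃⟩ := hnd'
    rw [List.nodup_cons] at hnd₂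
    refine ⟨M ⊔ M', l[2 * q + 2], hM.sup hM' ?_, List.getElem_mem _, ?_, l[2 * q + 1], ?_, ?_⟩
    · rw [hM.support_eq_verts, hM'.support_eq_verts, hv, hv', Set.disjoint_left]
      intro x hx hx'
      exact hnd₃ x hx x (List.mem_cons_of_mem _ hx') rfl
    · ext x
      have hx : x ∈ l ↔ x ∈ l.take (2 * q + 2) ∨ x = l[2 * q + 2] ∨ x ∈ l.drop (2 * q + 3) := by
        conv_lhs => rw [hsplit]
        rw [List.mem_append, List.mem_cons]
      simp only [Subgraph.verts_sup, hv, hv', Set.mem_union, Set.mem_ofPred_eq, Set.mem_sdiff,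
        Set.mem_singleton_iff, hx]
      constructor
      · rintro (h | h)
        · exact ⟨Or.inl h, hnd₃ x h _ List.mem_cons_self⟩
        · exact ⟨Or.inr (Or.inr h), fun he => hnd₂.1 (he ▸ h)⟩
      · rintro ⟨h | h | h, hne⟩
        · exact Or.inl h
        · exact absurd h hne
        · exact Or.inr h
    · rw [Subgraph.verts_sup, hv]
      exact Or.inl (List.mem_take_iff_getElem.2 ⟨2 * q + 1, by omega, rfl⟩)
    · exact (h₂ 0 (by omega)).symm

namespace ElimTree

variable {V : Type} {G : SimpleGraph V}

/-- `l` lists the vertices on the path from the root to `v`, in order. -/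
def IsPathTo (T : ElimTree G) (v : V) (l : List V) : Prop :=
  l.Pairwise T.anc ∧ ∀ u, u ∈ l ↔ T.anc u v ∨ u = v

theorem nodup_of_pairwise (T : ElimTree G) {l : List V} (h : l.Pairwise T.anc) : l.Nodup :=
  h.imp fun hab => by
    rintro rfl
    exact T.irrefl _ hab

theorem wellFounded_anc [Finite V] (T : ElimTree G) : WellFounded T.anc :=
  have : IsTrans V T.anc := ⟨T.trans⟩
  have : Std.Irrefl T.anc := ⟨T.irrefl⟩
  Finite.wellFounded_of_trans_of_irrefl _

theorem wellFounded_swap_anc [Finite V] (T : ElimTree G) : WellFounded (Function.swap T.anc) :=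
  have : IsTrans V (Function.swap T.anc) := ⟨fun a b c h h' => T.trans c b a h' h⟩
  have : Std.Irrefl (Function.swap T.anc) := ⟨T.irrefl⟩
  Finite.wellFounded_of_trans_of_irrefl _

theorem exists_isPathTo [Finite V] (T : ElimTree G) (v : V) : ∃ l, T.IsPathTo v l := by
  induction v using T.wellFounded_anc.induction with
  | _ v ih =>
    rcases Set.eq_empty_or_nonempty {u | T.anc u v} with he | hne
    · have hno : ∀ u, ¬ T.anc u v := fun u hu => by
        have : u ∈ {u | T.anc u v} := hu
        simp [he] at this
      exact ⟨[v], by simp, fun u => by simp [hno u]⟩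
    · obtain ⟨p, hp, hmax⟩ := T.wellFounded_swap_anc.has_min _ hne
      obtain ⟨l, hl, hmem⟩ := ih p hp
      have hlv : ∀ u ∈ l, T.anc u v := fun u hu => by
        rcases (hmem u).1 hu with h | rfl
        · exact T.trans _ _ _ h hp
        · exact hp
      refine ⟨l ++ [v], List.pairwise_append.2 ⟨hl, by simp, by simpa using hlv⟩, fun u => ?_⟩
      simp only [List.mem_append, List.mem_singleton]
      refine or_congr_left ⟨hlv u, fun hu => (hmem u).2 ?_⟩
      rcases T.chainAnc u p v hu hp with h | h | h
      · exact Or.inr h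
      · exact Or.inl h
      · exact absurd h (hmax u hu)

theorem IsPathTo.unique {T : ElimTree G} {v : V} {l l' : List V} (h : T.IsPathTo v l)
    (h' : T.IsPathTo v l') : l = l' := by
  refine List.Perm.eq_of_pairwise (le := T.anc) ?_ h.1 h'.1 ?_
  · exact fun a b _ _ hab hba => absurd (T.trans _ _ _ hab hba) (T.irrefl a)
  · rw [List.perm_ext_iff_of_nodup (T.nodup_of_pairwise h.1) (T.nodup_of_pairwise h'.1)]
    exact fun u => (h.2 u).trans (h'.2 u).symm

theorem IsPathTo.prefix_iff {T : ElimTree G} {u v : V} {l l' : List V} (h : T.IsPathTo u l)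
    (h' : T.IsPathTo v l') : l <+: l' ↔ T.anc u v ∨ u = v := by
  constructor
  · exact fun hp => (h'.2 u).1 (hp.subset ((h.2 u).2 (Or.inr rfl)))
  · intro huv
    obtain ⟨s, t, rfl⟩ := List.append_of_mem ((h'.2 u).2 huv)
    have hpw := h'.1
    rw [List.pairwise_append, List.pairwise_cons] at hpw
    obtain ⟨hs, ⟨hut, -⟩, hst⟩ := hpw
    have hsu : ∀ x ∈ s, T.anc x u := fun x hx => hst x hx u List.mem_cons_self
    have hsplit : T.IsPathTo u (s ++ [u]) := by
      refine ⟨List.pairwise_append.2 ⟨hs, by simp, by simpa using hsu⟩, fun x => ?_⟩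
      simp only [List.mem_append, List.mem_singleton]
      refine or_congr_left ⟨hsu x, fun hx => ?_⟩
      have hxv : T.anc x v ∨ x = v := by
        rcases huv with h | rfl
        · exact Or.inl (T.trans _ _ _ hx h)
        · exact Or.inl hx
      have hmem := (h'.2 x).2 hxv
      rw [List.mem_append, List.mem_cons] at hmem
      rcases hmem with h | rfl | h
      · exact h
      · exact absurd hx (T.irrefl x)
      · exact absurd (T.trans _ _ _ hx (hut x h)) (T.irrefl x)
    rw [h.unique hsplit]
    exact ⟨t, by simp⟩

theorem exists_leaf_above [Finite V] (T : ElimTree G) (v : V) :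
    ∃ w, (T.anc v w ∨ v = w) ∧ ∀ x, ¬ T.anc w x := by
  obtain ⟨w, hw, hmax⟩ := T.wellFounded_swap_anc.has_min {w | T.anc v w ∨ v = w} ⟨v, Or.inr rfl⟩
  refine ⟨w, hw, fun x hx => hmax x ?_ hx⟩
  rcases hw with h | rfl
  · exact Or.inl (T.trans _ _ _ h hx)
  · exact Or.inl hx

end ElimTree

theorem List.prefix_of_le_of_le {α : Type*} [LinearOrder α] :
    ∀ {p a b c : List α}, p <+: a → p <+: c → a ≤ b → b ≤ c → p <+: b
  | [], _, _, _, _, _, _, _ => List.nil_prefix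
  | x :: p, a, b, c, hpa, hpc, hab, hbc => by
    obtain ⟨a', rfl⟩ := hpa
    obtain ⟨c', rfl⟩ := hpc
    match b with
    | [] => exact absurd hab (by simp)
    | y :: b =>
      rw [List.cons_append, ← not_lt, List.cons_lt_cons_iff, not_or, not_lt] at hab hbc
      obtain rfl : x = y := le_antisymm hab.1 hbc.1
      simp only [true_and, not_lt] at hab hbc
      obtain ⟨t, ht⟩ := List.prefix_of_le_of_le (List.prefix_append p a')
        (List.prefix_append p c') hab.2 hbc.2
      exact ⟨t, by simp [← ht]⟩

/-- The root-to-leaf paths of a matched elimination tree, in lexicographic order, are the bags of a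
matched path decomposition. -/
theorem ElimTree.IsMatched.exists_treeDecomp {V : Type} [Fintype V] [Nonempty V]
    {G : SimpleGraph V} {T : ElimTree G} (hT : T.IsMatched) :
    ∃ D : TreeDecomp G, D.IsMatched ∧ ∀ i, (D.bag i).ncard ≤ T.depth := by
  classical
  choose path hpath using T.exists_isPathTo
  let L := {v : V // ∀ w, ¬ T.anc v w}
  let enum := Fintype.equivFin V
  let key : L → List (Fin (Fintype.card V)) := fun v => (path v.1).map enum
  have hprefix : ∀ u v, (path u).map enum <+: (path v).map enum ↔ T.anc u v ∨ u = v :=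
    fun u v => by
      rw [List.prefix_map_iff_of_injective enum.injective, (hpath u).prefix_iff (hpath v)]
  have hinj : Function.Injective key := fun v w hvw => by
    have h : T.anc v.1 w.1 ∨ v.1 = w.1 := (hprefix _ _).1 (by
      show key v <+: key w
      rw [hvw])
    exact Subtype.ext (h.resolve_left (v.2 _))
  let : LinearOrder L := LinearOrder.lift' key hinj
  have hL : Nonempty L := by
    obtain ⟨w, -, hw⟩ := T.exists_leaf_above (Classical.arbitrary V)
    exact ⟨⟨w, hw⟩⟩
  obtain ⟨n, hn⟩ : ∃ n, Fintype.card L = n + 1 :=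
    Nat.exists_eq_succ_of_ne_zero Fintype.card_ne_zero
  let e := Fintype.orderIsoFinOfCardEq L hn
  have hcov : ∀ v, ∃ i, T.anc v (e i).1 ∨ v = (e i).1 := fun v => by
    obtain ⟨w, hvw, hw⟩ := T.exists_leaf_above v
    exact ⟨e.symm ⟨w, hw⟩, by simpa using hvw⟩
  have hbelow : ∀ {u v w : V}, T.anc u v → T.anc v w ∨ v = w → T.anc u w ∨ u = w := by
    rintro u v w huv (h | rfl)
    · exact Or.inl (T.trans _ _ _ huv h)
    · exact Or.inl huv
  refine ⟨⟨Fin (n + 1), pathGraph (n + 1), isTree_pathGraph n,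
    fun i => {u | T.anc u (e i).1 ∨ u = (e i).1}, fun v => ?_, fun u v huv => ?_⟩, fun i => ?_,
    fun i => ?_⟩
  · refine connected_induce_pathGraph ⟨fun i hi k hk j hj => ?_⟩ (hcov v)
    have hij : key (e i) ≤ key (e j) := e.monotone hj.1
    have hjk : key (e j) ≤ key (e k) := e.monotone hj.2
    exact (hprefix _ _).1
      (List.prefix_of_le_of_le ((hprefix _ _).2 hi) ((hprefix _ _).2 hk) hij hjk)
  · rcases T.edgeComp u v huv with h | h
    · obtain ⟨i, hi⟩ := hcov v
      exact ⟨i, hbelow h hi, hi⟩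
    · obtain ⟨i, hi⟩ := hcov u
      exact ⟨i, hi, hbelow h hi⟩
  · have hp := hpath (e i).1
    have := (hT _ (e i).2 _ hp.1 hp.2).matchedSet (T.nodup_of_pairwise hp.1)
    simpa only [hp.2] using this
  · have h : {u | T.anc u (e i).1 ∨ u = (e i).1} = insert (e i).1 {u | T.anc u (e i).1} := by
      ext u
      simp [or_comm]
    show Set.ncard {u | T.anc u (e i).1 ∨ u = (e i).1} ≤ _
    rw [h]
    exact (Set.ncard_insert_le _ _).trans
      (Finset.le_sup (f := fun v => {u | T.anc u v}.ncard + 1) (Finset.mem_univ (e i).1))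

/-- The edge relation of the graph obtained from `G` by deleting the vertices of `S`. -/
def AdjOutside {V : Type} (G : SimpleGraph V) (S : Finset V) (x y : V) : Prop :=
  x ∉ S ∧ y ∉ S ∧ G.Adj x y

theorem reachOutside_symm {V : Type} {G : SimpleGraph V} {S : Finset V} {a b : V}
    (h : Relation.ReflTransGen (AdjOutside G S) a b) :
    Relation.ReflTransGen (AdjOutside G S) b a :=
  have : Std.Symm (AdjOutside G S) := ⟨fun _ _ hcd => ⟨hcd.2.1, hcd.1, hcd.2.2.symm⟩⟩
  Std.Symm.symm _ _ h

/-- `anc` is the strict order of a depth-first search forest on the explored vertex set `S`. -/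
structure IsPartialDFS {V : Type} (G : SimpleGraph V) (S : Finset V) (anc : V → V → Prop) :
    Prop where
  mem_left : ∀ {a b}, anc a b → a ∈ S
  mem_right : ∀ {a b}, anc a b → b ∈ S
  trans : ∀ {a b c}, anc a b → anc b c → anc a c
  irrefl : ∀ a, ¬ anc a a
  chain : ∀ {a b c}, anc a c → anc b c → a = b ∨ anc a b ∨ anc b a
  comparable : ∀ {u v}, u ∈ S → v ∈ S → G.Adj u v → anc u v ∨ anc v u
  cover_adj : ∀ {a b}, anc a b → (∀ c, anc a c → ¬ anc c b) → G.Adj a b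
  attach_chain : ∀ {u v x y}, u ∈ S → v ∈ S → x ∉ S → y ∉ S → G.Adj u x → G.Adj v y →
    Relation.ReflTransGen (AdjOutside G S) x y → u = v ∨ anc u v ∨ anc v u

/-- Exploring a vertex `y` whose ancestors are the down-closed chain `D`. -/
theorem IsPartialDFS.insert {V : Type} [DecidableEq V] {G : SimpleGraph V} {S : Finset V}
    {anc : V → V → Prop} (h : IsPartialDFS G S anc) {y : V} (hy : y ∉ S) {D : Set V}
    (hDS : ∀ a ∈ D, a ∈ S) (hdown : ∀ a b, anc a b → b ∈ D → a ∈ D)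
    (hchain : ∀ a ∈ D, ∀ b ∈ D, a = b ∨ anc a b ∨ anc b a)
    (hcover : ∀ a ∈ D, (∀ c ∈ D, ¬ anc a c) → G.Adj a y)
    (hattach : ∀ u ∈ S, ∀ x, x ∉ S → G.Adj u x →
      Relation.ReflTransGen (AdjOutside G S) y x → u ∈ D) :
    IsPartialDFS G (insert y S) fun a b => anc a b ∨ (b = y ∧ a ∈ D) := by
  have hyl : ∀ {a}, ¬ anc y a := fun ha => hy (h.mem_left ha)
  have hyr : ∀ {a}, ¬ anc a y := fun ha => hy (h.mem_right ha)
  have hyD : y ∉ D := fun hD => hy (hDS y hD)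
  have hmono : ∀ {a b}, Relation.ReflTransGen (AdjOutside G (Insert.insert y S)) a b →
      Relation.ReflTransGen (AdjOutside G S) a b := by
    have hle : AdjOutside G (Insert.insert y S) ≤ AdjOutside G S := fun c d hcd =>
      ⟨fun hc => hcd.1 (Finset.mem_insert_of_mem hc),
        fun hd => hcd.2.1 (Finset.mem_insert_of_mem hd), hcd.2.2⟩
    exact fun {a b} => Relation.ReflTransGen.mono hle a b
  refine ⟨?_, ?_, ?_, ?_, ?_, ?_, ?_, ?_⟩
  · rintro a b (hab | ⟨-, ha⟩)
    · exact Finset.mem_insert_of_mem (h.mem_left hab)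
    · exact Finset.mem_insert_of_mem (hDS a ha)
  · rintro a b (hab | ⟨rfl, -⟩)
    · exact Finset.mem_insert_of_mem (h.mem_right hab)
    · exact Finset.mem_insert_self _ _
  · rintro a b c (hab | ⟨rfl, ha⟩) (hbc | ⟨rfl, hb⟩)
    · exact Or.inl (h.trans hab hbc)
    · exact Or.inr ⟨rfl, hdown a b hab hb⟩
    · exact absurd hbc hyl
    · exact absurd hb hyD
  · rintro a (ha | ⟨rfl, ha⟩)
    · exact h.irrefl a ha
    · exact hyD ha
  · rintro a b c (hac | ⟨rfl, ha⟩) (hbc | ⟨hc, hb⟩)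
    · rcases h.chain hac hbc with h | h | h <;> simp [h]
    · exact absurd (hc ▸ hac) hyr
    · exact absurd hbc hyr
    · rcases hchain a ha b hb with h | h | h <;> simp [h]
  · intro u v hu hv huv
    rcases Finset.mem_insert.1 hu with rfl | hu' <;> rcases Finset.mem_insert.1 hv with rfl | hv'
    · exact absurd huv (G.loopless.irrefl _)
    · exact Or.inr (Or.inr ⟨rfl, hattach v hv' u hy huv.symm .refl⟩)
    · exact Or.inl (Or.inr ⟨rfl, hattach u hu' v hy huv .refl⟩)
    · rcases h.comparable hu' hv' huv with h | h <;> simp [h]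
  · rintro a b (hab | ⟨rfl, ha⟩) hno
    · exact h.cover_adj hab fun c hac hcb => hno c (Or.inl hac) (Or.inl hcb)
    · exact hcover a ha fun c hc hac => hno c (Or.inl hac) (Or.inr ⟨rfl, hc⟩)
  · intro u v x z hu hv hx hz hux hvz hxz
    have hx' : x ∉ S := fun hs => hx (Finset.mem_insert_of_mem hs)
    have hz' : z ∉ S := fun hs => hz (Finset.mem_insert_of_mem hs)
    rcases Finset.mem_insert.1 hu with rfl | hu' <;> rcases Finset.mem_insert.1 hv with rfl | hv'
    · exact Or.inl rfl
    · exact Or.inr (Or.inr (Or.inr ⟨rfl, hattach v hv' z hz' hvz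
        (.head ⟨hy, hx', hux⟩ (hmono hxz))⟩))
    · exact Or.inr (Or.inl (Or.inr ⟨rfl, hattach u hu' x hx' hux
        (.head ⟨hy, hz', hvz⟩ (reachOutside_symm (hmono hxz)))⟩))
    · rcases h.attach_chain hu' hv' hx' hz' hux hvz (hmono hxz) with h | h | h <;> simp [h]

theorem IsPartialDFS.exists_insert {V : Type} [Finite V] [DecidableEq V] {G : SimpleGraph V}
    {S : Finset V} {anc : V → V → Prop} (h : IsPartialDFS G S anc) {z : V} (hz : z ∉ S) :
    ∃ y ∉ S, ∃ anc', IsPartialDFS G (Insert.insert y S) anc' := by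
  let N : Set V := {u | u ∈ S ∧ ∃ x, x ∉ S ∧ G.Adj u x ∧
    Relation.ReflTransGen (AdjOutside G S) z x}
  rcases Set.eq_empty_or_nonempty N with hN | hN
  · refine ⟨z, hz, _, h.insert hz (D := ∅) (by simp) (by simp) (by simp) (by simp) ?_⟩
    intro u hu x hx hux hzx
    rw [← hN]
    exact ⟨hu, x, hx, hux, hzx⟩
  · have : IsTrans V (Function.swap anc) := ⟨fun a b c hab hbc => h.trans hbc hab⟩
    have : Std.Irrefl (Function.swap anc) := ⟨h.irrefl⟩
    obtain ⟨m, ⟨hmS, y, hy, hmy, hzy⟩, hmax⟩ :=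
      (Finite.wellFounded_of_trans_of_irrefl (Function.swap anc)).has_min N hN
    refine ⟨y, hy, _, h.insert hy (D := {a | anc a m ∨ a = m}) ?_ ?_ ?_ ?_ ?_⟩
    · rintro a (ha | rfl)
      · exact h.mem_left ha
      · exact hmS
    · rintro a b hab (hb | rfl)
      · exact Or.inl (h.trans hab hb)
      · exact Or.inl hab
    · rintro a (ha | rfl) b (hb | rfl)
      · exact h.chain ha hb
      · exact Or.inr (Or.inl ha)
      · exact Or.inr (Or.inr hb)
      · exact Or.inl rfl
    · rintro a (ha | rfl) hno
      · exact absurd ha (hno m (Or.inr rfl))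
      · exact hmy
    · intro u hu x hx hux hyx
      rcases h.attach_chain hu hmS hx hy hux hmy (reachOutside_symm hyx) with h' | h' | h'
      · exact Or.inr h'
      · exact Or.inl h'
      · exact absurd h' (hmax u ⟨hu, x, hx, hux, hzy.trans hyx⟩)

theorem exists_isPartialDFS_univ {V : Type} [Fintype V] (G : SimpleGraph V) :
    ∃ anc, IsPartialDFS G Finset.univ anc := by
  classical
  have key : ∀ n ≤ Fintype.card V, ∃ S : Finset V, S.card = n ∧ ∃ anc, IsPartialDFS G S anc := by
    intro n
    induction n with
    | zero =>
      exact fun _ => ⟨∅, rfl, fun _ _ => False, by constructor <;> simp⟩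
    | succ n ih =>
      intro hn
      obtain ⟨S, hS, anc, h⟩ := ih (by omega)
      obtain ⟨z, hz⟩ : ∃ z, z ∉ S := by
        by_contra! hall
        rw [Finset.eq_univ_iff_forall.2 hall, Finset.card_univ] at hS
        omega
      obtain ⟨y, hy, anc', h'⟩ := h.exists_insert hz
      exact ⟨_, by rw [Finset.card_insert_of_notMem hy, hS], anc', h'⟩
  obtain ⟨S, hS, anc, h⟩ := key _ le_rfl
  obtain rfl := Finset.eq_univ_of_card S hS
  exact ⟨anc, h⟩

/-- A depth-first search forest of the whole graph is an elimination tree. -/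
theorem IsPartialDFS.exists_elimTree {V : Type} [Fintype V] {G : SimpleGraph V}
    {anc : V → V → Prop} (h : IsPartialDFS G Finset.univ anc) :
    ∃ T : ElimTree G, T.anc = anc := by
  refine ⟨⟨anc, fun _ _ _ => h.trans, h.irrefl, fun _ _ _ => h.chain,
    fun u v => h.comparable (Finset.mem_univ u) (Finset.mem_univ v), fun v => ?_⟩, rfl⟩
  have : IsTrans V anc := ⟨fun a b c hab hbc => h.trans hab hbc⟩
  have : Std.Irrefl anc := ⟨h.irrefl⟩
  have : IsTrans V (Function.swap anc) := ⟨fun a b c hab hbc => h.trans hbc hab⟩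
  have : Std.Irrefl (Function.swap anc) := ⟨h.irrefl⟩
  let B : Set V := {w | w = v ∨ anc v w}
  have key : ∀ w (hw : w ∈ B), (G.induce B).Reachable ⟨v, Or.inl rfl⟩ ⟨w, hw⟩ := by
    intro w
    induction w using (Finite.wellFounded_of_trans_of_irrefl anc).induction with
    | _ w ih =>
      rintro (rfl | hw)
      · exact Reachable.refl _
      · obtain ⟨p, ⟨hpB, hpw⟩, hmax⟩ :=
          (Finite.wellFounded_of_trans_of_irrefl (Function.swap anc)).has_min
            {p | p ∈ B ∧ anc p w} ⟨v, Or.inl rfl, hw⟩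
        refine (ih p hpw hpB).trans (Adj.reachable ?_)
        refine h.cover_adj hpw fun c hpc hcw => hmax c ⟨?_, hcw⟩ hpc
        rcases hpB with rfl | hp
        · exact Or.inr hpc
        · exact Or.inr (h.trans hp hpc)
  have : Nonempty B := ⟨⟨v, Or.inl rfl⟩⟩
  exact ⟨fun a b => (key a a.2).symm.trans (key b b.2)⟩

theorem exists_isMatched_elimTree {V : Type} [Fintype V] {G : SimpleGraph V}
    (hG : ∀ v, ∃ w, G.Adj v w) : ∃ T : ElimTree G, T.IsMatched := by
  obtain ⟨anc, h⟩ := exists_isPartialDFS_univ G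
  obtain ⟨T, rfl⟩ := h.exists_elimTree
  refine ⟨T, fun v hv l hl hmem => ?_⟩
  have hlt : ∀ (i j : ℕ) (hi : i < l.length) (hj : j < l.length), i < j → T.anc l[i] l[j] :=
    fun i j hi hj hij => List.pairwise_iff_getElem.1 hl i j hi hj hij
  have hadj : ∀ (i : ℕ) (hi : i + 1 < l.length), G.Adj l[i] l[i + 1] := by
    intro i hi
    refine h.cover_adj (hlt i (i + 1) _ hi (by omega)) fun c hic hci => ?_
    have hc : c ∈ l := (hmem c).2 (Or.inl (by
      rcases (hmem l[i + 1]).1 (List.getElem_mem _) with h' | h'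
      · exact T.trans _ _ _ hci h'
      · exact h' ▸ hci))
    obtain ⟨j, hj, rfl⟩ := List.getElem_of_mem hc
    rcases lt_trichotomy j i with hji | rfl | hji
    · exact T.irrefl _ (T.trans _ _ _ hic (hlt j i hj _ hji))
    · exact T.irrefl _ hic
    · rcases eq_or_lt_of_le (Nat.succ_le_of_lt hji) with rfl | hji'
      · exact T.irrefl _ hci
      · exact T.irrefl _ (T.trans _ _ _ hci (hlt (i + 1) j hi hj hji'))
  have hlen : 2 ≤ l.length := by
    obtain ⟨w, hw⟩ := hG v
    have hwv : T.anc w v := (T.edgeComp v w hw).resolve_left (hv w)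
    obtain ⟨i, hi, hiw⟩ := List.getElem_of_mem ((hmem w).2 (Or.inl hwv))
    obtain ⟨j, hj, hjv⟩ := List.getElem_of_mem ((hmem v).2 (Or.inr rfl))
    by_contra hlt'
    obtain rfl : i = j := by omega
    exact hw.ne (hjv.symm.trans hiw)
  rcases Nat.even_or_odd l.length with he | ho
  · exact Or.inl ⟨he, fun j hj => hadj (2 * j) hj⟩
  · obtain ⟨k, hk⟩ := id ho
    exact Or.inr ⟨ho, 1, odd_one, by omega, fun j hj => hadj (2 * j) (by omega),
      fun b hb => hadj (1 + 2 * b) hb⟩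

theorem MatchedSet.exists_adj {V : Type} {G : SimpleGraph V} {S : Set V} (h : MatchedSet G S)
    {v : V} (hv : v ∈ S) : ∃ w, G.Adj v w := by
  rcases h with ⟨M, hM, rfl⟩ | ⟨M, x, hM, -, hS, u, -, hu⟩
  · obtain ⟨w, hw, -⟩ := hM hv
    exact ⟨w, hw.adj_sub⟩
  · by_cases hx : v = x
    · exact ⟨u, hx ▸ hu⟩
    · obtain ⟨w, hw, -⟩ := hM (v := v) (by rw [hS]; exact ⟨hv, hx⟩)
      exact ⟨w, hw.adj_sub⟩

theorem TreeDecomp.IsMatched.exists_adj {V : Type} {G : SimpleGraph V} {D : TreeDecomp G}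
    (hD : D.IsMatched) (v : V) : ∃ w, G.Adj v w := by
  obtain ⟨i, hi⟩ := (D.vert_conn v).nonempty
  exact (hD i).exists_adj hi

theorem exists_isMatched_treeDecomp_of_isEmpty {V : Type} [IsEmpty V] (G : SimpleGraph V) :
    ∃ D : TreeDecomp G, D.IsMatched ∧ ∀ i, (D.bag i).ncard = 0 := by
  refine ⟨⟨Fin 1, pathGraph 1, isTree_pathGraph 0, fun _ => ∅, isEmptyElim, isEmptyElim⟩,
    fun _ => Or.inl ⟨⊥, by simp [Subgraph.IsMatching], by simp⟩, fun _ => Set.ncard_empty V⟩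

/-- For any graph `G`, `mtw G ≤ mtd G + 1`; in particular matched treewidth
is finite for every (finite) graph. -/
theorem stmt6 {V : Type} [Fintype V] (G : SimpleGraph V) :
    mtw G ≤ mtd G + 1 := by
  by_cases hG : ∀ v, ∃ w, G.Adj v w
  · rcases isEmpty_or_nonempty V with hV | hV
    · obtain ⟨D, hD, hcard⟩ := exists_isMatched_treeDecomp_of_isEmpty G
      exact Nat.sInf_le ⟨D, hD, fun i => by simp [hcard i]⟩
    · obtain ⟨T₀, hT₀⟩ := exists_isMatched_elimTree hG
      obtain ⟨T, hT, hdepth⟩ : mtd G ∈ {d | ∃ T : ElimTree G, T.IsMatched ∧ T.depth = d} :=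
        Nat.sInf_mem ⟨_, T₀, hT₀, rfl⟩
      obtain ⟨D, hD, hcard⟩ := hT.exists_treeDecomp
      exact Nat.sInf_le ⟨D, hD, fun i => (hcard i).trans (by omega)⟩
  · have he : {k | ∃ D : TreeDecomp G, D.IsMatched ∧ ∀ i, (D.bag i).ncard ≤ k + 1} = ∅ :=
      Set.eq_empty_iff_forall_notMem.2 fun k ⟨_, hD, _⟩ => hG hD.exists_adj
    rw [mtw, he, Nat.sInf_empty]
    exact Nat.zero_le _
end

section
/- Let G be the graph obtained from K_{n,n} (n > 1) by adding edges within one side so that that side induces a path on n vertices. Then mtw(G) ≤ n, while mtw(K_{n,n}) = 2n − 2; hence matched treewidth is not monotone under taking subgraphs. -/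
/-- `K_{n,n}` together with a path `a₁ - a₂ - ⋯ - aₙ` on the left side. -/
def KnnPlusPath (n : ℕ) : SimpleGraph (Fin n ⊕ Fin n) :=
  completeBipartiteGraph (Fin n) (Fin n) ⊔
    SimpleGraph.fromRel (fun x y =>
      ∃ i j : Fin n, x = Sum.inl i ∧ y = Sum.inl j ∧ (i : ℕ) + 1 = (j : ℕ))

namespace SimpleGraph

/-- A set of vertices containing every vertex of every path between two of its members. -/
def PathConvex {ι : Type*} (T : SimpleGraph ι) (S : Set ι) : Prop :=
  ∀ ⦃u v : ι⦄, u ∈ S → v ∈ S → ∀ p : T.Walk u v, p.IsPath → ∀ w ∈ p.support, w ∈ S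

section Tree

variable {ι : Type*} {T : SimpleGraph ι}

lemma PathConvex.inter {S U : Set ι} (hS : T.PathConvex S) (hU : T.PathConvex U) :
    T.PathConvex (S ∩ U) :=
  fun _ _ hu hv p hp w hw => ⟨hS hu.1 hv.1 p hp w hw, hU hu.2 hv.2 p hp w hw⟩

lemma IsAcyclic.pathConvex (hT : T.IsAcyclic) {S : Set ι} (hS : (T.induce S).Preconnected) :
    T.PathConvex S := by
  intro u v hu hv p hp w hw
  obtain ⟨q, hq⟩ := (hS ⟨u, hu⟩ ⟨v, hv⟩).exists_isPath
  have hq' : (q.map (Embedding.induce (G := T) S).toHom).IsPath :=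
    hq.map Subtype.val_injective
  have h : p = q.map (Embedding.induce (G := T) S).toHom :=
    congrArg Subtype.val ((hT.subsingleton_path u v).elim ⟨p, hp⟩ ⟨_, hq'⟩)
  rw [(congrArg Walk.support h).trans (Walk.support_map _ _), List.mem_map] at hw
  obtain ⟨⟨z, hz⟩, -, rfl⟩ := hw
  exact hz

lemma Walk.exists_isPath_to_first_mem {x y : ι} (p : T.Walk x y) (hp : p.IsPath) {R : Set ι}
    (hy : y ∈ R) :
    ∃ m ∈ R, ∃ q : T.Walk x m, q.IsPath ∧ q.support ⊆ p.support ∧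
      ∀ v ∈ q.support, v ∈ R → v = m := by
  induction p with
  | nil => exact ⟨_, hy, Walk.nil, by simp, by simp, by simp⟩
  | @cons u v w h p ih =>
    by_cases hu : u ∈ R
    · exact ⟨u, hu, Walk.nil, by simp, by simp, by simp⟩
    · rw [Walk.cons_isPath_iff] at hp
      obtain ⟨m, hm, q, hq, hqp, hqR⟩ := ih hp.1 hy
      refine ⟨m, hm, Walk.cons h q, ?_, ?_, ?_⟩
      · exact (Walk.cons_isPath_iff h q).2 ⟨hq, fun hmem => hp.2 (hqp hmem)⟩
      · exact List.cons_subset_cons _ hqp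
      · intro a ha haR
        rw [Walk.support_cons, List.mem_cons] at ha
        rcases ha with rfl | ha
        · exact absurd haR hu
        · exact hqR a ha haR

lemma Connected.pathConvex_inter_nonempty (hT : T.Connected) {S U W : Set ι}
    (hS : T.PathConvex S) (hU : T.PathConvex U) (hW : T.PathConvex W)
    (hSU : (S ∩ U).Nonempty) (hUW : (U ∩ W).Nonempty) (hWS : (W ∩ S).Nonempty) :
    (S ∩ U ∩ W).Nonempty := by
  classical
  obtain ⟨x, hxS, hxU⟩ := hSU
  obtain ⟨y, hyU, hyW⟩ := hUW
  obtain ⟨z, hzW, hzS⟩ := hWS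
  obtain ⟨p, hp⟩ := (hT.preconnected x y).exists_isPath
  obtain ⟨r, hr⟩ := (hT.preconnected y z).exists_isPath
  obtain ⟨m, hm, q, hq, hqp, hqR⟩ :=
    p.exists_isPath_to_first_mem hp (R := {v | v ∈ r.support}) r.start_mem_support
  have hmr : m ∈ r.support := hm
  have hd := hr.dropUntil hmr
  have hpath : (q.append (r.dropUntil m hmr)).IsPath := by
    rw [Walk.isPath_def] at hq hd ⊢
    rw [Walk.support_append, List.nodup_append']
    refine ⟨hq, hd.tail, fun a ha ha' => ?_⟩
    obtain rfl := hqR a ha (r.support_dropUntil_subset_support hmr (List.mem_of_mem_tail ha'))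
    rw [← Walk.cons_tail_support] at hd
    exact (List.nodup_cons.1 hd).1 ha'
  exact ⟨m, ⟨hS hxS hzS _ hpath m (by simp), hU hxU hyU p hp m (hqp q.end_mem_support)⟩,
    hW hyW hzW r hr m hmr⟩

/-- The Helly property of subtrees. -/
lemma Connected.exists_mem_of_pathConvex (hT : T.Connected) {α : Type*} (s : Finset α)
    (F : α → Set ι) (hF : ∀ a ∈ s, T.PathConvex (F a))
    (hint : ∀ a ∈ s, ∀ b ∈ s, (F a ∩ F b).Nonempty) : ∃ i, ∀ a ∈ s, i ∈ F a := by
  classical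
  have := hT.nonempty
  induction s using Finset.induction_on generalizing F with
  | empty => simp
  | insert j s hj ih =>
    simp only [Finset.forall_mem_insert] at hF hint
    rcases s.eq_empty_or_nonempty with rfl | ⟨b, hb⟩
    · obtain ⟨i, hi, -⟩ := hint.1.1
      exact ⟨i, by simpa using hi⟩
    · obtain ⟨i, hi⟩ := ih (fun a => F a ∩ F j) (fun a ha => (hF.2 a ha).inter hF.1) (by
        intro a ha b hb
        obtain ⟨i, hi⟩ := hT.pathConvex_inter_nonempty (hF.2 a ha) (hF.2 b hb) hF.1
          ((hint.2 a ha).2 b hb) ((hint.2 b hb).1) (hint.1.2 a ha)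
        exact ⟨i, ⟨hi.1.1, hi.2⟩, hi.1.2, hi.2⟩)
      exact ⟨i, Finset.forall_mem_insert _ _ _ |>.2 ⟨(hi b hb).2, fun a ha => (hi a ha).1⟩⟩

end Tree

lemma Subgraph.exists_isMatching_of_adj {V ι : Type*} {G : SimpleGraph V} (f g : ι → V)
    (h : ∀ i, G.Adj (f i) (g i)) (hinj : Function.Injective (Sum.elim f g)) :
    ∃ M : G.Subgraph, M.IsMatching ∧ M.verts = Set.range f ∪ Set.range g := by
  refine ⟨⨆ i, G.subgraphOfAdj (h i), IsMatching.iSup (fun i => .subgraphOfAdj (h i)) ?_, ?_⟩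
  · intro i j hij
    rw [support_subgraphOfAdj, support_subgraphOfAdj, Set.disjoint_left]
    have key : ∀ x y, Sum.elim f g x = Sum.elim f g y → x = y := fun x y hxy => hinj hxy
    rintro a (rfl | rfl) (ha | ha)
    · exact hij (by simpa using key (.inl i) (.inl j) ha)
    · simpa using key (.inl i) (.inr j) ha
    · simpa using key (.inr i) (.inl j) ha
    · exact hij (by simpa using key (.inr i) (.inr j) ha)
  · ext a
    simp only [verts_iSup, subgraphOfAdj_verts, Set.mem_iUnion, Set.mem_insert_iff,
      Set.mem_singleton_iff, Set.mem_union, Set.mem_range, exists_or, eq_comm]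

lemma Subgraph.IsMatching.two_mul_ncard_le {V : Type*} [Finite V] {G : SimpleGraph V}
    {M : G.Subgraph} (hM : M.IsMatching) {X : Set V} (hX : G.IsIndepSet X) (hXM : X ⊆ M.verts) :
    2 * X.ncard ≤ M.verts.ncard := by
  choose f hf using fun v : X => (hM (hXM v.2)).exists
  have hdisj : Disjoint X (Set.range f) := by
    rw [Set.disjoint_left]
    rintro _ hx ⟨v, rfl⟩
    exact hX v.2 hx (hf v).ne (hf v).adj_sub
  have hinj : Function.Injective f := fun v w hvw =>
    Subtype.ext (hM.eq_of_adj_right (hf v) (hvw ▸ hf w))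
  have hcard : (Set.range f).ncard = X.ncard := by
    rw [← Set.image_univ, Set.ncard_image_of_injective _ hinj, Set.ncard_univ,
      Nat.card_coe_set_eq]
  have hsub : X ∪ Set.range f ⊆ M.verts := by
    rintro _ (hx | ⟨v, rfl⟩)
    · exact hXM hx
    · exact (hf v).snd_mem
  have := Set.ncard_le_ncard hsub (Set.toFinite _)
  rw [Set.ncard_union_eq hdisj (Set.toFinite _) (Set.toFinite _), hcard] at this
  omega

end SimpleGraph

open SimpleGraph

lemma MatchedSet.two_mul_ncard_le {V : Type} [Finite V] {G : SimpleGraph V} {S X : Set V}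
    (h : MatchedSet G S) (hX : G.IsIndepSet X) (hXS : X ⊆ S) : 2 * X.ncard ≤ S.ncard + 1 := by
  rcases h with ⟨M, hM, rfl⟩ | ⟨M, v, hM, hv, hS, -⟩
  · exact (hM.two_mul_ncard_le hX hXS).trans (Nat.le_succ _)
  · have h1 := hM.two_mul_ncard_le (X := X \ {v}) (hX.mono Set.sdiff_subset)
      (hS ▸ Set.sdiff_subset_sdiff_left hXS)
    rw [hS] at h1
    have h2 := Set.ncard_sdiff_singleton_add_one hv (Set.toFinite _)
    have h3 := Set.pred_ncard_le_ncard_sdiff_singleton X v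
    omega

/-- A finite path with at least one edge spans a matched set. -/
lemma matchedSet_image_Iic {V : Type} {G : SimpleGraph V} (f : ℕ → V) {m : ℕ} (hm : 1 ≤ m)
    (hinj : Set.InjOn f (Set.Iic m)) (hadj : ∀ i < m, G.Adj (f i) (f (i + 1))) :
    MatchedSet G (f '' Set.Iic m) := by
  obtain ⟨k, hk⟩ : ∃ k, k = (m + 1) / 2 := ⟨_, rfl⟩
  obtain ⟨M, hM, hMv⟩ := Subgraph.exists_isMatching_of_adj (G := G)
    (fun i : Fin k => f (2 * i)) (fun i : Fin k => f (2 * i + 1))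
    (fun i => hadj _ (by omega)) (by
      have key : ∀ i j, i ≤ m → j ≤ m → f i = f j → i = j := fun i j hi hj h => hinj hi hj h
      rintro (i | i) (j | j) h <;> have := key _ _ (by omega) (by omega) h <;>
        simp [Fin.ext_iff] <;> omega)
  have hMv' : M.verts = f '' Set.Iio (2 * k) := by
    rw [hMv]
    ext a
    constructor
    · rintro (⟨i, rfl⟩ | ⟨i, rfl⟩)
      · exact ⟨_, by simp only [Set.mem_Iio]; omega, rfl⟩
      · exact ⟨_, by simp only [Set.mem_Iio]; omega, rfl⟩
    · rintro ⟨j, hj, rfl⟩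
      simp only [Set.mem_Iio] at hj
      rcases Nat.even_or_odd' j with ⟨c, rfl | rfl⟩
      · exact Or.inl ⟨⟨c, by omega⟩, rfl⟩
      · exact Or.inr ⟨⟨c, by omega⟩, rfl⟩
  rcases Nat.even_or_odd' m with ⟨c, rfl | rfl⟩
  · obtain rfl : k = c := by omega
    refine Or.inr ⟨M, f (2 * k), hM, ⟨_, by simp, rfl⟩, ?_, f (2 * k - 1), ?_, ?_⟩
    · rw [hMv', ← Set.image_singleton, ← hinj.image_sdiff_subset (by simp)]
      congr 1
      ext j
      simp only [Set.mem_Iio, Set.mem_sdiff, Set.mem_Iic, Set.mem_singleton_iff]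
      omega
    · rw [hMv']
      exact ⟨_, by simp only [Set.mem_Iio]; omega, rfl⟩
    · have := hadj (2 * k - 1) (by omega)
      rw [show 2 * k - 1 + 1 = 2 * k by omega] at this
      exact this.symm
  · obtain rfl : k = c + 1 := by omega
    refine Or.inl ⟨M, hM, ?_⟩
    rw [hMv']
    congr 1
    ext j
    simp only [Set.mem_Iio, Set.mem_Iic]
    omega

/-- A family of bags in which every vertex lies in all bags or in exactly one is
a tree decomposition, over any tree, as soon as it covers the edges. -/
lemma exists_treeDecomp_of_bags {V ι : Type} [Nonempty ι] {G : SimpleGraph V}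
    (bag : ι → Set V) (hv : ∀ v, {i | v ∈ bag i} = Set.univ ∨ ∃ j, {i | v ∈ bag i} = {j})
    (he : ∀ u v, G.Adj u v → ∃ i, u ∈ bag i ∧ v ∈ bag i) :
    ∃ D : TreeDecomp G, ∀ i, ∃ j, D.bag i = bag j := by
  have hT := isTree_starGraph (Classical.arbitrary ι)
  refine ⟨⟨ι, _, hT, bag, fun v => ?_, he⟩, fun i => ⟨i, rfl⟩⟩
  rcases hv v with h | ⟨j, h⟩
  · rw [h]
    exact induceUnivIso _ |>.connected_iff.2 hT.connected
  · rw [h]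
    exact { preconnected := .of_subsingleton, nonempty := inferInstance }

/-- A tree decomposition of a complete bipartite graph has a bag containing a whole side. -/
lemma TreeDecomp.exists_side_subset_bag {α β : Type} [Finite α] [Finite β]
    (D : TreeDecomp (completeBipartiteGraph α β)) :
    ∃ i, Set.range Sum.inl ⊆ D.bag i ∨ Set.range Sum.inr ⊆ D.bag i := by
  have := Fintype.ofFinite α
  have := Fintype.ofFinite β
  have hT := D.isTree
  have hconv : ∀ v, D.tree.PathConvex {i | v ∈ D.bag i} := fun v =>
    hT.isAcyclic.pathConvex (D.vert_conn v).preconnected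
  by_cases hα : ∀ a b : α, ({i | .inl a ∈ D.bag i} ∩ {i | .inl b ∈ D.bag i}).Nonempty
  · obtain ⟨i, hi⟩ := hT.connected.exists_mem_of_pathConvex Finset.univ
      (fun a : α => {i | .inl a ∈ D.bag i}) (fun a _ => hconv _) (fun a _ b _ => hα a b)
    exact ⟨i, Or.inl (by rintro _ ⟨a, rfl⟩; exact hi a (Finset.mem_univ _))⟩
  by_cases hβ : ∀ a b : β, ({i | .inr a ∈ D.bag i} ∩ {i | .inr b ∈ D.bag i}).Nonempty
  · obtain ⟨i, hi⟩ := hT.connected.exists_mem_of_pathConvex Finset.univ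
      (fun a : β => {i | .inr a ∈ D.bag i}) (fun a _ => hconv _) (fun a _ b _ => hβ a b)
    exact ⟨i, Or.inr (by rintro _ ⟨a, rfl⟩; exact hi a (Finset.mem_univ _))⟩
  exfalso
  push Not at hα hβ
  obtain ⟨a, a', haa⟩ := hα
  obtain ⟨b, b', hbb⟩ := hβ
  have hedge : ∀ (a : α) (b : β), ∃ i, .inl a ∈ D.bag i ∧ .inr b ∈ D.bag i := fun a b =>
    D.edge_cover _ _ (by simp [completeBipartiteGraph])
  obtain ⟨x, hxa, hxb⟩ := hedge a b
  obtain ⟨y, hya, hyb⟩ := hedge a' b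
  obtain ⟨z, hza, hzb⟩ := hedge a' b'
  obtain ⟨w, hwa, hwb⟩ := hedge a b'
  have hunion : D.tree.PathConvex ({i | .inl a ∈ D.bag i} ∪ {i | .inr b' ∈ D.bag i}) :=
    hT.isAcyclic.pathConvex (induce_union_connected (D.vert_conn _).preconnected
      (D.vert_conn _).preconnected ⟨w, hwa, hwb⟩).preconnected
  obtain ⟨m, ⟨hm | hm, hm'⟩, hm''⟩ := hT.connected.pathConvex_inter_nonempty hunion
    (hconv (.inr b)) (hconv (.inl a')) ⟨x, Or.inl hxa, hxb⟩ ⟨y, hyb, hya⟩ ⟨z, hza, Or.inr hzb⟩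
  · exact Set.notMem_empty m (haa.subset ⟨hm, hm''⟩)
  · exact Set.notMem_empty m (hbb.subset ⟨hm', hm⟩)

lemma mtw_knnPlusPath_le (n : ℕ) (hn : 1 < n) : mtw (KnnPlusPath n) ≤ n := by
  have : Nonempty (Fin n) := ⟨⟨0, by omega⟩⟩
  obtain ⟨D, hD⟩ := exists_treeDecomp_of_bags (G := KnnPlusPath n)
    (fun j : Fin n => insert (.inr j) (Set.range Sum.inl)) (by
      rintro (i | j)
      · exact Or.inl (by simp)
      · exact Or.inr ⟨j, by ext; simp [eq_comm]⟩) (by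
      rintro (i | i) (j | j) h
      · exact ⟨i, by simp⟩
      · exact ⟨j, by simp⟩
      · exact ⟨i, by simp⟩
      · simp [KnnPlusPath] at h)
  refine Nat.sInf_le ⟨D, fun i => ?_, fun i => ?_⟩
  · obtain ⟨j, hj⟩ := hD i
    rw [hj]
    let f : ℕ → Fin n ⊕ Fin n := fun i =>
      if h : 1 ≤ i ∧ i ≤ n then .inl ⟨i - 1, by omega⟩ else .inr j
    have hf : insert (.inr j) (Set.range Sum.inl) = f '' Set.Iic n := by
      ext v
      constructor
      · rintro (rfl | ⟨i, rfl⟩)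
        · exact ⟨0, by simp, by simp [f]⟩
        · exact ⟨i + 1, by simp only [Set.mem_Iic]; omega, by simp [f]⟩
      · rintro ⟨i, hi, rfl⟩
        simp only [f]
        split <;> simp
    rw [hf]
    apply matchedSet_image_Iic f (by omega)
    · intro a ha b hb hab
      simp only [Set.mem_Iic] at ha hb
      simp only [f] at hab
      split at hab <;> split at hab <;> simp at hab <;> omega
    · intro i hi
      rcases Nat.eq_zero_or_pos i with rfl | hi0
      · simp [f, KnnPlusPath, show 1 ≤ n by omega]
      · have h1 : 1 ≤ i ∧ i ≤ n := by omega
        have h2 : i + 1 ≤ n := by omega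
        simp only [f, KnnPlusPath, h1, h2, sup_adj, fromRel_adj]
        refine Or.inr ⟨by simp; omega, Or.inl ⟨_, _, rfl, rfl, by simp; omega⟩⟩
  · obtain ⟨j, hj⟩ := hD i
    rw [hj]
    refine (Set.ncard_insert_le _ _).trans ?_
    rw [← Set.image_univ, Set.ncard_image_of_injective _ Sum.inl_injective]
    simp

lemma exists_isMatched_treeDecomp_completeBipartiteGraph (n : ℕ) (hn : 1 < n) :
    ∃ D : TreeDecomp (completeBipartiteGraph (Fin n) (Fin n)),
      D.IsMatched ∧ ∀ i, (D.bag i).ncard ≤ 2 * n - 2 + 1 := by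
  have : Nontrivial (Fin n) := Fin.nontrivial_iff_two_le.2 hn
  obtain ⟨c₀, c₁, hc⟩ := exists_pair_ne (Fin n)
  obtain ⟨D, hD⟩ := exists_treeDecomp_of_bags (G := completeBipartiteGraph (Fin n) (Fin n))
    (fun t : Bool => {Sum.inl (if t then c₀ else c₁)}ᶜ) (by
      rintro (i | j)
      · by_cases h0 : i = c₀
        · exact Or.inr ⟨false, by ext t; cases t <;> simp [h0, hc]⟩
        by_cases h1 : i = c₁
        · exact Or.inr ⟨true, by ext t; cases t <;> simp [h1, hc.symm]⟩
        · exact Or.inl (by ext t; cases t <;> simp [h0, h1])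
      · exact Or.inl (by simp)) (by
      rintro (i | i) (j | j) h
      · simp [completeBipartiteGraph] at h
      · by_cases h0 : i = c₀
        · exact ⟨false, by simp [h0, hc]⟩
        · exact ⟨true, by simp [h0]⟩
      · by_cases h0 : j = c₀
        · exact ⟨false, by simp [h0, hc]⟩
        · exact ⟨true, by simp [h0]⟩
      · simp [completeBipartiteGraph] at h)
  refine ⟨D, fun i => ?_, fun i => ?_⟩
  · obtain ⟨t, ht⟩ := hD i
    rw [ht]
    generalize (if t then c₀ else c₁) = c
    obtain ⟨d, hd⟩ := exists_ne c
    obtain ⟨M, hM, hMv⟩ := Subgraph.exists_isMatching_of_adj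
      (G := completeBipartiteGraph (Fin n) (Fin n))
      (fun i : {i // i ≠ c} => Sum.inl i.1) (fun i : {i // i ≠ c} => Sum.inr i.1)
      (by simp [completeBipartiteGraph]) (by
        rintro (i | i) (j | j) h <;> simp at h <;> simp [Subtype.ext_iff, h])
    refine Or.inr ⟨M, .inr c, hM, by simp, ?_, .inl d, ?_, by simp [completeBipartiteGraph]⟩
    · rw [hMv]
      ext (i | i) <;> simp
    · rw [hMv]
      simp [hd]
  · obtain ⟨t, ht⟩ := hD i
    rw [ht, Set.ncard_compl]
    simp
    omega

/-- Adding a path on one side of `K_{n,n}` drops the matched treewidth to at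
most `n`, whereas `mtw (K_{n,n}) = 2n − 2`; hence matched treewidth is not
monotone under taking subgraphs. -/
theorem stmt8 (n : ℕ) (hn : 1 < n) :
    mtw (KnnPlusPath n) ≤ n ∧
    mtw (completeBipartiteGraph (Fin n) (Fin n)) = 2 * n - 2 := by
  refine ⟨mtw_knnPlusPath_le n hn, le_antisymm
    (Nat.sInf_le (exists_isMatched_treeDecomp_completeBipartiteGraph n hn))
    (le_csInf ⟨_, exists_isMatched_treeDecomp_completeBipartiteGraph n hn⟩ ?_)⟩
  rintro k ⟨D, hD, hk⟩
  have hcard : ∀ f : Fin n → Fin n ⊕ Fin n, Function.Injective f →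
      (Set.range f).ncard = n := fun f hf => by
    rw [← Set.image_univ, Set.ncard_image_of_injective _ hf]
    simp
  obtain ⟨i, hi | hi⟩ := D.exists_side_subset_bag
  · have := (hD i).two_mul_ncard_le (by
      rintro _ ⟨a, rfl⟩ _ ⟨b, rfl⟩ -
      simp [completeBipartiteGraph]) hi
    rw [hcard _ Sum.inl_injective] at this
    have := hk i
    omega
  · have := (hD i).two_mul_ncard_le (by
      rintro _ ⟨a, rfl⟩ _ ⟨b, rfl⟩ -
      simp [completeBipartiteGraph]) hi
    rw [hcard _ Sum.inr_injective] at this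
    have := hk i
    omega
end
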